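/- arXiv:1901.02657 — 5 statements merged into one kernel-verified Lean document; each statement's English description precedes it below -/
import Mathlib

section
/- Let Γ be a countably infinite discrete group acting on a compact metrizable space X by homeomorphisms. If the naive topological entropy h^nv(Γ↷X) is positive, then the action is Li-Yorke chaotic. -/
open scoped ENNReal NNReal

/-- A finite open cover of `X`, encoded as a `Finset` of open sets whose union is `X`. -/
def IsFinOpenCover {X : Type*} [TopologicalSpace X] (𝒰 : Finset (Set X)) : Prop :=
  (∀ U ∈ 𝒰, IsOpen U) ∧ ⋃₀ (𝒰 : Set (Set X)) = Set.univ

/-- `N(𝒰)`: the minimal cardinality of a subcover of `𝒰`. -/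
noncomputable def coverNum {X : Type*} (𝒰 : Finset (Set X)) : ℕ :=
  sInf {n | ∃ 𝒱 : Finset (Set X), 𝒱 ⊆ 𝒰 ∧ ⋃₀ (𝒱 : Set (Set X)) = Set.univ ∧ 𝒱.card = n}

/-- `𝒰^F = ⋁_{s ∈ F} s⁻¹𝒰`: the join of the pullbacks of `𝒰` by the elements of `F`,
consisting of all intersections `⋂_{s ∈ F} s⁻¹ U_s` over choices `U_s ∈ 𝒰`. -/
noncomputable def jointCover {Γ : Type*} [Group Γ] {X : Type*} [MulAction Γ X]
    (F : Finset Γ) (𝒰 : Finset (Set X)) : Finset (Set X) := by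
  classical
  exact (F.pi fun _ => 𝒰).image fun ω => ⋂ s : Γ, ⋂ h : s ∈ F, (fun x : X => s • x) ⁻¹' ω s h

/-- The naive topological entropy
`h^nv(Γ ↷ X) = sup_𝒰 inf_F (1/|F|) log N(𝒰^F)`, where `𝒰` ranges over finite open
covers of `X` and `F` over nonempty finite subsets of `Γ`, as an extended nonnegative real. -/
noncomputable def naiveEntropy (Γ X : Type*) [Group Γ] [TopologicalSpace X] [MulAction Γ X] :
    ℝ≥0∞ :=
  ⨆ 𝒰 : {𝒰 : Finset (Set X) // IsFinOpenCover 𝒰},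
    ⨅ F : {F : Finset Γ // F.Nonempty},
      ENNReal.ofReal (Real.log (coverNum (jointCover F.1 𝒰.1) : ℝ) / (F.1.card : ℝ))

open Finset in
/-- A `k`-ary Sauer–Shelah bound. -/
theorem card_mul_pow_le_of_shattered_card_le {ι : Type*} [Fintype ι] [Nonempty ι] {t : ℝ}
    (ht : 0 < t) (ht1 : t ≤ 1) (n : ℕ) (S : Finset (Fin n → ι)) (m : ℕ)
    (hS : ∀ W : Finset (Fin n), (∀ τ : Fin n → ι, ∃ σ ∈ S, ∀ i ∈ W, σ i = τ i) → #W ≤ m) :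
    (#S : ℝ) * t ^ m ≤ ((Fintype.card ι : ℝ) - 1 + t) ^ n := by
  classical
  have hk : (1 : ℝ) ≤ Fintype.card ι := by exact_mod_cast Fintype.card_pos
  induction n generalizing m with
  | zero =>
    have h1 : (#S : ℝ) ≤ 1 := by
      exact_mod_cast Finset.card_le_one_of_subsingleton S
    simpa using mul_le_one₀ h1 (by positivity) (pow_le_one₀ ht.le ht1)
  | succ n ih =>
    set S₀ : Finset (Fin n → ι) := S.image Fin.tail with hS₀
    set S₁ : Finset (Fin n → ι) := univ.filter fun y => ∀ a, (Fin.cons a y : Fin (n + 1) → ι) ∈ S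
      with hS₁
    set R := (Fintype.card ι : ℝ) - 1 + t
    have hcard : (#S : ℝ) ≤ ((Fintype.card ι : ℝ) - 1) * #S₀ + #S₁ := by
      have h1 : #S = ∑ y ∈ S₀, #{x ∈ S | Fin.tail x = y} :=
        card_eq_sum_card_fiberwise fun x hx => mem_image_of_mem _ hx
      have h2 : ∀ y ∈ S₀, (#{x ∈ S | Fin.tail x = y} : ℝ) ≤
          ((Fintype.card ι : ℝ) - 1) + if y ∈ S₁ then 1 else 0 := by
        intro y _
        have h3 : #{x ∈ S | Fin.tail x = y} ≤ #{a : ι | (Fin.cons a y : Fin (n + 1) → ι) ∈ S} := by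
          refine card_le_card_of_injOn (fun x => x 0) ?_ ?_
          · intro x hx
            simp only [coe_filter, Set.mem_ofPred_eq, mem_univ, true_and] at hx ⊢
            rw [← hx.2, Fin.cons_self_tail]
            exact hx.1
          · intro x hx x' hx' h
            simp only [coe_filter, Set.mem_ofPred_eq] at hx hx'
            rw [← Fin.cons_self_tail x, ← Fin.cons_self_tail x', hx.2, hx'.2]
            exact congrArg (fun a => (Fin.cons a y : Fin (n + 1) → ι)) h
        by_cases hy : y ∈ S₁
        · have : #{a : ι | (Fin.cons a y : Fin (n + 1) → ι) ∈ S} ≤ Fintype.card ι := card_le_univ _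
          have h4 : (#{x ∈ S | Fin.tail x = y} : ℝ) ≤ Fintype.card ι := by
            exact_mod_cast h3.trans this
          simpa [hy] using h4
        · have : #{a : ι | (Fin.cons a y : Fin (n + 1) → ι) ∈ S} < Fintype.card ι := by
            refine card_lt_univ_of_notMem (x := ?_) ?_
            · simp only [hS₁, mem_filter, mem_univ, true_and, not_forall] at hy
              exact hy.choose
            · simp only [hS₁, mem_filter, mem_univ, true_and, not_forall] at hy ⊢
              exact hy.choose_spec
          have h4 : (#{x ∈ S | Fin.tail x = y} : ℝ) + 1 ≤ Fintype.card ι := by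
            exact_mod_cast Nat.succ_le_of_lt (h3.trans_lt this)
          simp only [hy, if_false]
          linarith
      have h5 : ∑ y ∈ S₀, (if y ∈ S₁ then (1 : ℝ) else 0) ≤ #S₁ := by
        rw [← sum_filter, sum_const, nsmul_eq_mul, mul_one]
        exact_mod_cast card_le_card fun y hy => (mem_filter.mp hy).2
      calc (#S : ℝ) = ∑ y ∈ S₀, (#{x ∈ S | Fin.tail x = y} : ℝ) := by rw [h1]; push_cast; rfl
        _ ≤ ∑ y ∈ S₀, (((Fintype.card ι : ℝ) - 1) + if y ∈ S₁ then 1 else 0) := sum_le_sum h2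
        _ ≤ _ := by
          rw [sum_add_distrib, sum_const, nsmul_eq_mul, mul_comm]
          gcongr
    have hS₀le : (#S₀ : ℝ) * t ^ m ≤ R ^ n := by
      refine ih S₀ m fun W hW => ?_
      rw [← card_map (Fin.succEmb n)]
      refine hS _ fun τ => ?_
      obtain ⟨y, hy, hyW⟩ := hW (Fin.tail τ)
      obtain ⟨x, hx, rfl⟩ := mem_image.mp hy
      refine ⟨x, hx, fun i hi => ?_⟩
      obtain ⟨j, hj, rfl⟩ := mem_map.mp hi
      exact hyW j hj
    have key : ∀ W : Finset (Fin n), (∀ τ : Fin n → ι, ∃ σ ∈ S₁, ∀ i ∈ W, σ i = τ i) →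
        #W + 1 ≤ m := by
      intro W hW
      have h0 : (0 : Fin (n + 1)) ∉ W.map (Fin.succEmb n) := by simp
      rw [← card_map (Fin.succEmb n), ← card_insert_of_notMem h0]
      refine hS _ fun τ => ?_
      obtain ⟨y, hy, hyW⟩ := hW (Fin.tail τ)
      refine ⟨Fin.cons (τ 0) y, (mem_filter.mp hy).2 _, fun i hi => ?_⟩
      rcases mem_insert.mp hi with rfl | hi
      · rfl
      · obtain ⟨j, hj, rfl⟩ := mem_map.mp hi
        simpa [Fin.tail] using hyW j hj
    have hS₁le : (#S₁ : ℝ) * t ^ m ≤ t * R ^ n := by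
      rcases m with _ | m
      · have : S₁ = ∅ := by
          by_contra hne
          obtain ⟨y, hy⟩ := nonempty_iff_ne_empty.mpr hne
          simpa using key ∅ fun τ => ⟨y, hy, by simp⟩
        have hR : 0 ≤ R := by simp only [R]; linarith
        simp only [this, card_empty, Nat.cast_zero, zero_mul]
        positivity
      · have := ih S₁ m fun W hW => by have := key W hW; omega
        rw [pow_succ]
        nlinarith
    calc (#S : ℝ) * t ^ m ≤ (((Fintype.card ι : ℝ) - 1) * #S₀ + #S₁) * t ^ m := by gcongr
      _ = ((Fintype.card ι : ℝ) - 1) * (#S₀ * t ^ m) + #S₁ * t ^ m := by ring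
      _ ≤ ((Fintype.card ι : ℝ) - 1) * R ^ n + t * R ^ n := by
        gcongr
      _ = R ^ (n + 1) := by simp only [R]; ring

open Finset in
theorem exists_shattered_of_pow_le_card {ι : Type*} [Fintype ι] [Nonempty ι] {ε : ℝ}
    (hε : 0 < ε) (hε1 : ε ≤ 1) : ∃ q : ℕ, 0 < q ∧ ∀ (n : ℕ) (S : Finset (Fin n → ι)),
      ((Fintype.card ι : ℝ) - 1 + ε) ^ n ≤ #S →
      ∃ W : Finset (Fin n), (∀ τ : Fin n → ι, ∃ σ ∈ S, ∀ i ∈ W, σ i = τ i) ∧ n ≤ q * #W := by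
  have hk : (1 : ℝ) ≤ Fintype.card ι := by exact_mod_cast Fintype.card_pos
  set r := ((Fintype.card ι : ℝ) - 1 + ε) / ((Fintype.card ι : ℝ) - 1 + ε / 2) with hr
  have hden : 0 < (Fintype.card ι : ℝ) - 1 + ε / 2 := by linarith
  have hr1 : 1 < r := by rw [hr, one_lt_div hden]; linarith
  obtain ⟨q, hq⟩ := pow_unbounded_of_one_lt (ε / 2)⁻¹ hr1
  have hq0 : 0 < q := by
    rcases Nat.eq_zero_or_pos q with rfl | h
    · have : (1 : ℝ) ≤ (ε / 2)⁻¹ := (one_le_inv₀ (by positivity)).mpr (by linarith)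
      simp only [pow_zero] at hq
      linarith
    · exact h
  refine ⟨q, hq0, fun n S hS => ?_⟩
  by_contra! hcon
  have hSne : S.Nonempty := by
    rw [← card_pos]
    have : 0 < ((Fintype.card ι : ℝ) - 1 + ε) ^ n := pow_pos (by linarith) _
    exact_mod_cast this.trans_le hS
  have hn : 0 < n := by
    obtain ⟨σ, hσ⟩ := hSne
    simpa using hcon ∅ fun τ => ⟨σ, hσ, by simp⟩
  set m := (n - 1) / q
  have hm : q * m ≤ n - 1 := Nat.mul_div_le _ _
  have h1 := card_mul_pow_le_of_shattered_card_le (half_pos hε) (by linarith) n S m fun W hW => by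
    rw [Nat.le_div_iff_mul_le hq0, mul_comm]
    have := hcon W hW
    omega
  have h2 : r ^ n * (ε / 2) ^ m ≤ 1 := by
    rw [hr, div_pow, div_mul_eq_mul_div, div_le_one (by positivity)]
    exact (mul_le_mul_of_nonneg_right hS (by positivity)).trans h1
  have h3 : (r ^ q) ^ m < r ^ n := by
    rw [← pow_mul]
    exact pow_lt_pow_right₀ hr1 (by omega)
  have h4 : (ε / 2)⁻¹ ^ m ≤ (r ^ q) ^ m := by gcongr
  have h5 : (1 : ℝ) = (ε / 2)⁻¹ ^ m * (ε / 2) ^ m := by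
    rw [← mul_pow, inv_mul_cancel₀ (by positivity), one_pow]
  have h6 : (ε / 2)⁻¹ ^ m * (ε / 2) ^ m < r ^ n * (ε / 2) ^ m :=
    mul_lt_mul_of_pos_right (h4.trans_lt h3) (by positivity)
  linarith

open Finset in
open Classical in
/-- The sets of coordinates shattered by a family of partially defined binary words. -/
noncomputable def partialShatterer {n : ℕ} (S : Set (Fin n → Option Bool)) :
    Finset (Finset (Fin n)) :=
  {W | ∀ τ : Fin n → Bool, ∃ σ ∈ S, ∀ i ∈ W, σ i = some (τ i)}

theorem mem_partialShatterer {n : ℕ} {S : Set (Fin n → Option Bool)} {W : Finset (Fin n)} :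
    W ∈ partialShatterer S ↔ ∀ τ : Fin n → Bool, ∃ σ ∈ S, ∀ i ∈ W, σ i = some (τ i) := by
  simp [partialShatterer]

open Finset in
theorem card_partialShatterer_tail_le {n : ℕ} (S : Set (Fin (n + 1) → Option Bool)) :
    #(partialShatterer (Fin.tail '' S : Set (Fin n → Option Bool))) ≤ #(partialShatterer S) := by
  refine card_le_card_of_injOn (fun W => W.map (Fin.succEmb n)) ?_ (map_injective _).injOn
  intro W hW
  rw [mem_coe, mem_partialShatterer] at hW ⊢
  intro τ
  obtain ⟨_, ⟨x, hx, rfl⟩, hyW⟩ := hW (Fin.tail τ)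
  refine ⟨x, hx, fun i hi => ?_⟩
  obtain ⟨j, hj, rfl⟩ := mem_map.mp hi
  exact hyW j hj

open Finset in
theorem card_partialShatterer_add_le {n : ℕ} (S : Set (Fin (n + 1) → Option Bool)) :
    #(partialShatterer {y : Fin n → Option Bool | (Fin.cons (some false) y : _ → _) ∈ S}) +
      #(partialShatterer {y : Fin n → Option Bool | (Fin.cons (some true) y : _ → _) ∈ S}) ≤
      #(partialShatterer S) := by
  classical
  set P := partialShatterer {y : Fin n → Option Bool | (Fin.cons (some false) y : _ → _) ∈ S}
    with hP
  set Q := partialShatterer {y : Fin n → Option Bool | (Fin.cons (some true) y : _ → _) ∈ S}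
    with hQ
  have h0 : ∀ W : Finset (Fin n), (0 : Fin (n + 1)) ∉ W.map (Fin.succEmb n) := by simp
  have hinj : Function.Injective fun W : Finset (Fin n) => W.map (Fin.succEmb n) :=
    map_injective _
  have hinj' : Function.Injective fun W : Finset (Fin n) => insert 0 (W.map (Fin.succEmb n)) := by
    intro W W' h
    refine hinj ?_
    have := congrArg (fun V : Finset (Fin (n + 1)) => V.erase 0) h
    simpa only [erase_insert (h0 _)] using this
  have hdisj : Disjoint ((P ∪ Q).image fun W => W.map (Fin.succEmb n))
      ((P ∩ Q).image fun W => insert 0 (W.map (Fin.succEmb n))) := by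
    rw [disjoint_left]
    intro V hV hV'
    obtain ⟨W, _, rfl⟩ := mem_image.mp hV
    obtain ⟨W', _, h⟩ := mem_image.mp hV'
    exact h0 W (h ▸ mem_insert_self _ _)
  rw [← card_union_add_card_inter, ← card_image_of_injective _ hinj,
    ← card_image_of_injective (P ∩ Q) hinj', ← card_union_of_disjoint hdisj]
  refine card_le_card (union_subset ?_ ?_)
  · intro V hV
    obtain ⟨W, hW, rfl⟩ := mem_image.mp hV
    rw [mem_partialShatterer]
    intro τ
    have : ∃ b, ∃ y : Fin n → Option Bool, (Fin.cons (some b) y : Fin (n + 1) → Option Bool) ∈ S ∧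
        ∀ i ∈ W, y i = some (Fin.tail τ i) := by
      rcases mem_union.mp hW with hW | hW
      · exact ⟨false, mem_partialShatterer.mp hW _⟩
      · exact ⟨true, mem_partialShatterer.mp hW _⟩
    obtain ⟨b, y, hy, hyW⟩ := this
    refine ⟨_, hy, fun i hi => ?_⟩
    obtain ⟨j, hj, rfl⟩ := mem_map.mp hi
    simpa [Fin.tail] using hyW j hj
  · intro V hV
    obtain ⟨W, hW, rfl⟩ := mem_image.mp hV
    rw [mem_inter] at hW
    rw [mem_partialShatterer]
    intro τ
    have : ∃ y : Fin n → Option Bool,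
        (Fin.cons (some (τ 0)) y : Fin (n + 1) → Option Bool) ∈ S ∧
        ∀ i ∈ W, y i = some (Fin.tail τ i) := by
      rcases τ 0 with _ | _
      · exact mem_partialShatterer.mp hW.1 _
      · exact mem_partialShatterer.mp hW.2 _
    obtain ⟨y, hy, hyW⟩ := this
    refine ⟨_, hy, fun i hi => ?_⟩
    rcases mem_insert.mp hi with rfl | hi
    · rfl
    · obtain ⟨j, hj, rfl⟩ := mem_map.mp hi
      simpa [Fin.tail] using hyW j hj

open Finset in
/-- A family of partial binary words can be completed by few total words if it shatters few sets. -/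
theorem exists_completions_card_le (β : ℕ) (n : ℕ) (S : Set (Fin n → Option Bool)) :
    ∃ 𝒲 : Finset (Fin n → Bool), (∀ σ ∈ S, ∃ w ∈ 𝒲, ∀ i b, σ i = some b → w i = b) ∧
      (#𝒲 : ℝ) ≤ (#(partialShatterer S) : ℝ) ^ β * (1 + (1 / 2) ^ β) ^ n := by
  classical
  induction n with
  | zero =>
    rcases S.eq_empty_or_nonempty with rfl | ⟨σ, hσ⟩
    · exact ⟨∅, by simp, by simp only [card_empty, Nat.cast_zero]; positivity⟩
    · refine ⟨univ, fun σ _ => ⟨default, mem_univ _, fun i => i.elim0⟩, ?_⟩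
      have : 1 ≤ #(partialShatterer S) :=
        card_pos.mpr ⟨∅, mem_partialShatterer.mpr fun τ => ⟨σ, hσ, by simp⟩⟩
      have : (1 : ℝ) ≤ #(partialShatterer S) := by exact_mod_cast this
      simpa using one_le_pow₀ this
  | succ n ih =>
    have hb : ∃ b, 2 * #(partialShatterer
        {y : Fin n → Option Bool | (Fin.cons (some b) y : _ → _) ∈ S}) ≤
        #(partialShatterer S) := by
      have := card_partialShatterer_add_le S
      by_contra! h
      have h1 := h false
      have h2 := h true
      omega
    obtain ⟨b, hb⟩ := hb
    obtain ⟨𝒲, h𝒲, hc⟩ := ih (Fin.tail '' S)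
    obtain ⟨𝒱, h𝒱, hd⟩ := ih {y : Fin n → Option Bool | (Fin.cons (some b) y : _ → _) ∈ S}
    refine ⟨𝒲.image (fun w => Fin.cons (!b) w) ∪ 𝒱.image (fun w => Fin.cons b w), ?_, ?_⟩
    · intro σ hσ
      by_cases h : σ 0 = some b
      · obtain ⟨w, hw, hwσ⟩ := h𝒱 (Fin.tail σ) (by
          rw [Set.mem_ofPred_eq, ← h, Fin.cons_self_tail]; exact hσ)
        refine ⟨_, mem_union_right _ (mem_image_of_mem _ hw), fun i => ?_⟩
        refine Fin.cases ?_ (fun j c hj => ?_) i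
        · intro c hc; rw [h] at hc; simpa using hc
        · simpa using hwσ j c hj
      · obtain ⟨w, hw, hwσ⟩ := h𝒲 (Fin.tail σ) ⟨σ, hσ, rfl⟩
        refine ⟨_, mem_union_left _ (mem_image_of_mem _ hw), fun i => ?_⟩
        refine Fin.cases ?_ (fun j c hj => ?_) i
        · intro c hc
          rw [hc] at h
          cases b <;> cases c <;> simp_all
        · simpa using hwσ j c hj
    · have h1 : (#(partialShatterer (Fin.tail '' S : Set (Fin n → Option Bool))) : ℝ) ≤
          #(partialShatterer S) := by exact_mod_cast card_partialShatterer_tail_le S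
      have h2 : (#(partialShatterer
          {y : Fin n → Option Bool | (Fin.cons (some b) y : _ → _) ∈ S}) : ℝ) ≤
          #(partialShatterer S) * (1 / 2) := by
        have : (2 : ℝ) * #(partialShatterer
          {y : Fin n → Option Bool | (Fin.cons (some b) y : _ → _) ∈ S}) ≤
          #(partialShatterer S) := by exact_mod_cast hb
        linarith
      have h3 : (#(𝒲.image (fun w => (Fin.cons (!b) w : Fin (n + 1) → Bool)) ∪
          𝒱.image (fun w => Fin.cons b w)) : ℝ) ≤ #𝒲 + #𝒱 := by
        exact_mod_cast (card_union_le _ _).trans (add_le_add card_image_le card_image_le)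
      calc _ ≤ (#𝒲 : ℝ) + #𝒱 := h3
        _ ≤ (#(partialShatterer S) : ℝ) ^ β * (1 + (1 / 2) ^ β) ^ n +
            (#(partialShatterer S) * (1 / 2) : ℝ) ^ β * (1 + (1 / 2) ^ β) ^ n :=
          add_le_add (hc.trans (by gcongr)) (hd.trans (by gcongr))
        _ = _ := by rw [mul_pow, pow_succ]; ring

open Finset in
theorem card_mul_pow_le_one_add_pow {n m : ℕ} {t : ℝ} (ht : 0 < t) (ht1 : t ≤ 1)
    (𝒮 : Finset (Finset (Fin n))) (h : ∀ W ∈ 𝒮, #W ≤ m) : (#𝒮 : ℝ) * t ^ m ≤ (1 + t) ^ n := by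
  calc (#𝒮 : ℝ) * t ^ m = ∑ W ∈ 𝒮, t ^ m := by rw [sum_const, nsmul_eq_mul]
    _ ≤ ∑ W ∈ 𝒮, t ^ #W := sum_le_sum fun W hW => pow_le_pow_of_le_one ht.le ht1 (h W hW)
    _ ≤ ∑ W : Finset (Fin n), t ^ #W :=
      sum_le_sum_of_subset_of_nonneg (subset_univ _) fun _ _ _ => by positivity
    _ = (1 + t) ^ n := by
      have := Fintype.sum_pow_mul_eq_add_pow (Fin n) t (1 : ℝ)
      simpa [add_comm] using this

open Finset in
theorem exists_partial_shattered_or_few_completions {h : ℝ} (hh : 0 < h) :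
    ∃ q : ℕ, 0 < q ∧ ∀ (n : ℕ) (S : Set (Fin n → Option Bool)),
      (∃ W ∈ partialShatterer S, n ≤ q * #W) ∨
      ∃ 𝒲 : Finset (Fin n → Bool), (∀ σ ∈ S, ∃ w ∈ 𝒲, ∀ i b, σ i = some b → w i = b) ∧
        (#𝒲 : ℝ) ≤ Real.exp (h * n) := by
  have he : 1 < Real.exp (h / 4) := Real.one_lt_exp_iff.mpr (by positivity)
  obtain ⟨β, hβ, hβ0⟩ : ∃ β : ℕ, 1 + (1 / 2 : ℝ) ^ β ≤ Real.exp (h / 4) ∧ β ≠ 0 := by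
    obtain ⟨β, hβ⟩ := exists_pow_lt_of_lt_one (sub_pos.mpr he) (by norm_num : (1 / 2 : ℝ) < 1)
    refine ⟨β + 1, ?_, by simp⟩
    have : (1 / 2 : ℝ) ^ (β + 1) ≤ (1 / 2) ^ β :=
      pow_le_pow_of_le_one (by norm_num) (by norm_num) (Nat.le_succ _)
    linarith
  obtain ⟨t, ht, ht1, htβ⟩ : ∃ t : ℝ, 0 < t ∧ t ≤ 1 ∧ (1 + t) ^ β ≤ Real.exp (h / 4) := by
    refine ⟨min 1 (h / 4 / β), by positivity, min_le_left _ _, ?_⟩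
    have hβp : (0 : ℝ) < β := by positivity
    calc (1 + min 1 (h / 4 / β)) ^ β ≤ (Real.exp (h / 4 / β)) ^ β := by
          gcongr
          have := Real.add_one_le_exp (h / 4 / β)
          have := min_le_right 1 (h / 4 / β)
          linarith
      _ = Real.exp (h / 4) := by
        rw [← Real.exp_nat_mul]; congr 1; field_simp
  obtain ⟨q, hq⟩ := pow_unbounded_of_one_lt ((t ^ β)⁻¹) he
  have hq' : (t ^ β)⁻¹ ≤ Real.exp (h / 4) ^ (q + 1) :=
    hq.le.trans (pow_le_pow_right₀ he.le (Nat.le_succ _))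
  refine ⟨q + 1, by simp, fun n S => ?_⟩
  by_contra! hcon
  obtain ⟨hcon, hW⟩ := hcon
  obtain ⟨𝒲, h𝒲, hc⟩ := exists_completions_card_le β n S
  have hlt := hW 𝒲 h𝒲
  refine absurd hc (not_le.mpr (lt_of_le_of_lt ?_ hlt))
  rcases (partialShatterer S).eq_empty_or_nonempty with h0 | ⟨W₀, hW₀⟩
  · rw [h0]; simp only [card_empty, Nat.cast_zero]; rw [zero_pow hβ0, zero_mul]; positivity
  have hn : 0 < n := by have := hcon W₀ hW₀; omega
  set m := (n - 1) / (q + 1)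
  have hm : (q + 1) * m ≤ n := (Nat.mul_div_le _ _).trans (Nat.sub_le _ _)
  have h1 := card_mul_pow_le_one_add_pow (m := m) ht ht1 (partialShatterer S) fun W hW => by
    rw [Nat.le_div_iff_mul_le (by simp), mul_comm]
    have := hcon W hW
    omega
  set N := (#(partialShatterer S) : ℝ)
  have h2 : N ≤ (1 + t) ^ n * (t ^ m)⁻¹ := by
    rw [← div_eq_mul_inv, le_div_iff₀ (by positivity)]; exact h1
  calc N ^ β * (1 + (1 / 2) ^ β) ^ n
      ≤ ((1 + t) ^ n * (t ^ m)⁻¹) ^ β * Real.exp (h / 4) ^ n := by gcongr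
    _ = ((1 + t) ^ β) ^ n * ((t ^ β)⁻¹) ^ m * Real.exp (h / 4) ^ n := by
      rw [mul_pow, ← pow_mul, ← pow_mul, mul_comm n β, inv_pow, inv_pow, ← pow_mul, ← pow_mul,
        mul_comm m β]
    _ ≤ Real.exp (h / 4) ^ n * (Real.exp (h / 4) ^ (q + 1)) ^ m * Real.exp (h / 4) ^ n := by
      gcongr
    _ ≤ Real.exp (h / 4) ^ n * Real.exp (h / 4) ^ n * Real.exp (h / 4) ^ n := by
      rw [← pow_mul]
      gcongr
      exact he.le
    _ = Real.exp (3 / 4 * (h * n)) := by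
      rw [← Real.exp_nat_mul, ← Real.exp_add, ← Real.exp_add]; congr 1; ring
    _ ≤ Real.exp (h * n) := by
      refine Real.exp_le_exp.mpr ?_
      have : 0 ≤ h * n := by positivity
      linarith

/-- A family of labels `(h, A)`, each imposing `(h * s) • x ∈ A i` at a position `s : Γ`, has
positive independence density if every finite set of positions contains a proportional subset that
can be labelled so that all choices of indices are realised by points. -/
def PosIndepDensity {Γ X ι : Type*} [Group Γ] [MulAction Γ X] (𝒜 : Set (Γ × (ι → Set X))) : Prop :=
  ∃ c : ℝ, 0 < c ∧ ∀ F : Finset Γ, ∃ J ⊆ F, c * F.card ≤ J.card ∧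
    ∃ ω : Γ → Γ × (ι → Set X), (∀ s ∈ J, ω s ∈ 𝒜) ∧
      ∀ σ : Γ → ι, ∃ x : X, ∀ s ∈ J, ((ω s).1 * s) • x ∈ (ω s).2 (σ s)

namespace PosIndepDensity

variable {Γ X ι : Type*} [Group Γ] [MulAction Γ X] {𝒜 : Set (Γ × (ι → Set X))}

theorem nonempty (h : PosIndepDensity 𝒜) : 𝒜.Nonempty := by
  obtain ⟨c, hc, h⟩ := h
  obtain ⟨J, -, hJ, ω, hω, -⟩ := h {1}
  have : 0 < J.card := by
    have : (0 : ℝ) < J.card := lt_of_lt_of_le (by simpa using hc) hJ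
    exact_mod_cast this
  obtain ⟨s, hs⟩ := Finset.card_pos.mp this
  exact ⟨_, hω s hs⟩

theorem restrict_nonempty (h : PosIndepDensity 𝒜) :
    PosIndepDensity {L ∈ 𝒜 | ∀ i, (L.2 i).Nonempty} := by
  obtain ⟨c, hc, h⟩ := h
  refine ⟨c, hc, fun F => ?_⟩
  obtain ⟨J, hJF, hJ, ω, hω, hx⟩ := h F
  refine ⟨J, hJF, hJ, ω, fun s hs => ⟨hω s hs, fun i => ?_⟩, hx⟩
  obtain ⟨x, hx⟩ := hx fun _ => i
  exact ⟨_, hx s hs⟩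

end PosIndepDensity

/-- An infinite group contains arbitrarily large finite sets whose quotients avoid a given finite
set. -/
theorem exists_finset_card_eq_mul_inv_notMem {Γ : Type*} [Group Γ] [Infinite Γ] {Ψ : Set Γ}
    (hΨ : Ψ.Finite) (N : ℕ) :
    ∃ K : Finset Γ, K.card = N ∧ ∀ k ∈ K, ∀ k' ∈ K, k ≠ k' → k' * k⁻¹ ∉ Ψ := by
  classical
  induction N with
  | zero => exact ⟨∅, by simp⟩
  | succ N ih =>
    obtain ⟨K, hK, hK'⟩ := ih
    set P := hΨ.toFinset
    obtain ⟨g, hg⟩ := Infinite.exists_notMem_finset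
      (K ∪ (Finset.image₂ (fun p k => p * k) P K ∪ Finset.image₂ (fun p k => p⁻¹ * k) P K))
    simp only [Finset.mem_union, not_or, Finset.mem_image₂, not_exists, not_and] at hg
    obtain ⟨hgK, hg1, hg2⟩ := hg
    refine ⟨insert g K, by rw [Finset.card_insert_of_notMem hgK, hK], ?_⟩
    intro k hk k' hk' hne hmem
    rcases Finset.mem_insert.mp hk with hkg | hkK <;>
      rcases Finset.mem_insert.mp hk' with hkg' | hkK'
    · exact hne (hkg.trans hkg'.symm)
    · subst hkg
      exact hg2 _ (hΨ.mem_toFinset.mpr hmem) k' hkK' (by group)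
    · subst hkg'
      exact hg1 _ (hΨ.mem_toFinset.mpr hmem) k hkK (by group)
    · exact hK' k hkK k' hkK' hne hmem

/-- A proportional part of `F` has pairwise disjoint translates `K f`. -/
theorem exists_subset_disjoint_translates {Γ : Type*} [Group Γ] {K : Finset Γ} (hK : K.Nonempty)
    (F : Finset Γ) : ∃ F' ⊆ F, F.card ≤ K.card ^ 2 * F'.card ∧
      ∀ f ∈ F', ∀ f' ∈ F', ∀ k ∈ K, ∀ k' ∈ K, k * f = k' * f' → f = f' := by
  classical
  obtain ⟨F', hF', hcov, hdis⟩ : ∃ F' ⊆ F, (∀ f ∈ F, ∃ f' ∈ F', ∃ k ∈ K, ∃ k' ∈ K,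
      k * f = k' * f') ∧ ∀ f ∈ F', ∀ f' ∈ F', ∀ k ∈ K, ∀ k' ∈ K, k * f = k' * f' → f = f' := by
    induction F using Finset.induction_on with
    | empty => exact ⟨∅, by simp⟩
    | insert g F _ ih =>
      obtain ⟨F', hF', hcov, hdis⟩ := ih
      by_cases hg : ∃ f' ∈ F', ∃ k ∈ K, ∃ k' ∈ K, k * g = k' * f'
      · refine ⟨F', hF'.trans (Finset.subset_insert _ _), fun f hf => ?_, hdis⟩
        rcases Finset.mem_insert.mp hf with rfl | hf
        · exact hg
        · exact hcov f hf
      · refine ⟨insert g F', Finset.insert_subset_insert _ hF', fun f hf => ?_, ?_⟩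
        · rcases Finset.mem_insert.mp hf with rfl | hf
          · obtain ⟨k, hk⟩ := hK
            exact ⟨f, Finset.mem_insert_self _ _, k, hk, k, hk, rfl⟩
          · obtain ⟨f', hf', h⟩ := hcov f hf
            exact ⟨f', Finset.mem_insert_of_mem hf', h⟩
        · intro f hf f' hf' k hk k' hk' h
          rcases Finset.mem_insert.mp hf with hfg | hfF <;>
            rcases Finset.mem_insert.mp hf' with hfg' | hfF'
          · exact hfg.trans hfg'.symm
          · subst hfg
            exact absurd ⟨f', hfF', k, hk, k', hk', h⟩ hg
          · subst hfg'
            exact absurd ⟨f, hfF, k', hk', k, hk, h.symm⟩ hg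
          · exact hdis f hfF f' hfF' k hk k' hk' h
  refine ⟨F', hF', ?_, hdis⟩
  have hsub : F ⊆ ((K ×ˢ K) ×ˢ F').image fun p => p.1.1⁻¹ * (p.1.2 * p.2) := by
    intro f hf
    obtain ⟨f', hf', k, hk, k', hk', h⟩ := hcov f hf
    refine Finset.mem_image.mpr ⟨((k, k'), f'), by simp [hk, hk', hf'], ?_⟩
    simp [← h]
  calc F.card ≤ _ := Finset.card_le_card hsub
    _ ≤ _ := Finset.card_image_le
    _ = K.card ^ 2 * F'.card := by rw [Finset.card_product, Finset.card_product]; ring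

open Finset in
theorem PosIndepDensity.exists_inter {Γ X ι ι' : Type*} [Group Γ] [Infinite Γ] [MulAction Γ X]
    {𝒜 : Set (Γ × (ι → Set X))} (hfin : 𝒜.Finite) (h : PosIndepDensity 𝒜) (p q : ι' → ι)
    {Φ : Set Γ} (hΦ : Φ.Finite) :
    ∃ 𝒜' : Set (Γ × (ι' → Set X)), 𝒜'.Finite ∧ PosIndepDensity 𝒜' ∧
      ∀ L' ∈ 𝒜', ∃ L ∈ 𝒜, ∃ M ∈ 𝒜, ∃ g ∉ Φ,
        L'.2 = fun l => L.2 (p l) ∩ {x | g • x ∈ M.2 (q l)} := by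
  classical
  obtain ⟨c, hc, hdens⟩ := h
  set Ψ : Set Γ := (fun t : (Γ × (ι → Set X)) × (Γ × (ι → Set X)) × Γ =>
    t.1.1⁻¹ * t.2.2 * t.2.1.1) '' (𝒜 ×ˢ 𝒜 ×ˢ Φ) with hΨ
  have hΨfin : Ψ.Finite := (hfin.prod (hfin.prod hΦ)).image _
  obtain ⟨N, hN⟩ := exists_nat_gt (2 / c)
  have hN0 : (0 : ℝ) < N := lt_trans (by positivity) hN
  have hNc : 2 ≤ c * N := by rw [div_lt_iff₀ hc] at hN; linarith
  obtain ⟨K, hKN, hK⟩ := exists_finset_card_eq_mul_inv_notMem hΨfin N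
  have hKne : K.Nonempty := card_pos.mp (by rw [hKN]; exact_mod_cast hN0)
  let mk : ((Γ × (ι → Set X)) × (Γ × (ι → Set X))) × (Γ × Γ) → Γ × (ι' → Set X) := fun t =>
    (t.1.1.1 * t.2.1, fun l => t.1.1.2 (p l) ∩
      {x | (t.1.2.1 * t.2.2 * (t.1.1.1 * t.2.1)⁻¹) • x ∈ t.1.2.2 (q l)})
  refine ⟨mk '' {t | (t.1.1 ∈ 𝒜 ∧ t.1.2 ∈ 𝒜) ∧ t.2.1 ∈ K ∧ t.2.2 ∈ K ∧ t.2.1 ≠ t.2.2}, ?_, ?_, ?_⟩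
  · refine Set.Finite.image _ (((hfin.prod hfin).prod (K ×ˢ K).finite_toSet).subset ?_)
    rintro ⟨⟨L, M⟩, k, k'⟩ ⟨h1, h2, h3, -⟩
    exact ⟨h1, by simpa using ⟨h2, h3⟩⟩
  · refine ⟨1 / (N : ℝ) ^ 3, by positivity, fun F => ?_⟩
    obtain ⟨F', hF', hcard, hdis⟩ := exists_subset_disjoint_translates hKne F
    rw [hKN] at hcard
    have hinj : Set.InjOn (fun t : Γ × Γ => t.1 * t.2) (K ×ˢ F' : Finset (Γ × Γ)) := by
      rintro ⟨k, f⟩ h1 ⟨k', f'⟩ h2 h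
      simp only [coe_product, Set.mem_prod, mem_coe] at h1 h2 h
      obtain rfl := hdis f h1.2 f' h2.2 k h1.1 k' h2.1 h
      simpa using h
    obtain ⟨J, hJ, hJc, ω, hω, hx⟩ := hdens ((K ×ˢ F').image fun t => t.1 * t.2)
    rw [card_image_of_injOn hinj, card_product, hKN] at hJc
    set E := F'.filter fun f => ∃ k ∈ K, ∃ k' ∈ K, k ≠ k' ∧ k * f ∈ J ∧ k' * f ∈ J with hE
    have hEc : J.card ≤ F'.card + N * E.card := by
      have h1 : J ⊆ F'.biUnion fun f => (K.filter fun k => k * f ∈ J).image fun k => k * f := by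
        intro s hs
        obtain ⟨⟨k, f⟩, hkf, rfl⟩ := mem_image.mp (hJ hs)
        rw [mem_product] at hkf
        exact mem_biUnion.mpr ⟨f, hkf.2, mem_image.mpr ⟨k, mem_filter.mpr ⟨hkf.1, hs⟩, rfl⟩⟩
      calc J.card ≤ ∑ f ∈ F', ((K.filter fun k => k * f ∈ J).image fun k => k * f).card :=
            (card_le_card h1).trans card_biUnion_le
        _ ≤ ∑ f ∈ F', (1 + if f ∈ E then N else 0) := by
          refine sum_le_sum fun f hf => card_image_le.trans ?_
          split_ifs with hfE
          · have := card_filter_le K fun k => k * f ∈ J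
            omega
          · rw [add_zero, card_le_one]
            intro k hk k' hk'
            by_contra hne
            rw [mem_filter] at hk hk'
            exact hfE (mem_filter.mpr ⟨hf, k, hk.1, k', hk'.1, hne, hk.2, hk'.2⟩)
        _ = F'.card + N * E.card := by
          rw [sum_add_distrib, ← sum_filter, sum_const, sum_const,
            filter_mem_eq_inter, inter_eq_right.mpr (filter_subset _ _)]
          rw [smul_eq_mul, smul_eq_mul, mul_one, mul_comm]
    have hEF : (F.card : ℝ) ≤ N ^ 3 * E.card := by
      have h1 : (F.card : ℝ) ≤ N ^ 2 * F'.card := by exact_mod_cast hcard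
      have h2 : (J.card : ℝ) ≤ F'.card + N * E.card := by exact_mod_cast hEc
      have h3 : 2 * (F'.card : ℝ) ≤ J.card :=
        le_trans (by
          push_cast
          nlinarith [Nat.cast_nonneg (α := ℝ) F'.card]) hJc
      calc (F.card : ℝ) ≤ N ^ 2 * F'.card := h1
        _ ≤ N ^ 2 * (N * E.card) := by gcongr; linarith
        _ = _ := by ring
    have hEspec : ∀ f ∈ E, ∃ k k', k ∈ K ∧ k' ∈ K ∧ k ≠ k' ∧ k * f ∈ J ∧ k' * f ∈ J := by
      intro f hf
      obtain ⟨k, hk, k', hk', h⟩ := (mem_filter.mp hf).2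
      exact ⟨k, k', hk, hk', h⟩
    choose! a b ha hb hab haJ hbJ using hEspec
    refine ⟨E, (filter_subset _ _).trans hF', ?_,
      fun f => mk ((ω (a f * f), ω (b f * f)), (a f, b f)), ?_, ?_⟩
    · rw [div_mul_eq_mul_div, div_le_iff₀ (by positivity)]
      linarith
    · intro f hf
      exact ⟨_, ⟨⟨hω _ (haJ f hf), hω _ (hbJ f hf)⟩, ha f hf, hb f hf, hab f hf⟩, rfl⟩
    · intro σ
      have hσ : ∃ σ' : Γ → ι, ∀ f ∈ E, σ' (a f * f) = p (σ f) ∧ σ' (b f * f) = q (σ f) := by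
        refine ⟨fun s => if h : ∃ f ∈ E, s = a f * f then p (σ h.choose) else
          if h : ∃ f ∈ E, s = b f * f then q (σ h.choose) else p (σ 1), fun f hf => ⟨?_, ?_⟩⟩
        · have h : ∃ f' ∈ E, a f * f = a f' * f' := ⟨f, hf, rfl⟩
          have h2 := hdis f (filter_subset _ _ hf) _ (filter_subset _ _ h.choose_spec.1)
            _ (ha f hf) _ (ha _ h.choose_spec.1) h.choose_spec.2
          simp only [dif_pos h]
          rw [← h2]
        · have h0 : ¬∃ f' ∈ E, b f * f = a f' * f' := by
            rintro ⟨f', hf', h⟩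
            obtain rfl := hdis f (filter_subset _ _ hf) _ (filter_subset _ _ hf')
              _ (hb f hf) _ (ha _ hf') h
            exact hab f hf (mul_right_cancel h).symm
          have h : ∃ f' ∈ E, b f * f = b f' * f' := ⟨f, hf, rfl⟩
          have h2 := hdis f (filter_subset _ _ hf) _ (filter_subset _ _ h.choose_spec.1)
            _ (hb f hf) _ (hb _ h.choose_spec.1) h.choose_spec.2
          simp only [dif_neg h0, dif_pos h]
          rw [← h2]
      obtain ⟨σ', hσ'⟩ := hσ
      obtain ⟨x, hx⟩ := hx σ'
      refine ⟨x, fun f hf => ⟨?_, ?_⟩⟩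
      · have := hx _ (haJ f hf)
        rw [(hσ' f hf).1, ← mul_assoc] at this
        exact this
      · have := hx _ (hbJ f hf)
        rw [(hσ' f hf).2, ← mul_assoc] at this
        rw [Set.mem_ofPred_eq, smul_smul]
        simpa [mk, mul_assoc] using this
  · rintro _ ⟨⟨⟨L, M⟩, k, k'⟩, ⟨⟨hL, hM⟩, hk, hk', hne⟩, rfl⟩
    refine ⟨L, hL, M, hM, _, fun hg => hK k hk k' hk' hne ?_, rfl⟩
    refine ⟨(M, L, _), ⟨hM, hL, hg⟩, ?_⟩
    simp only
    group

open Finset in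
theorem PosIndepDensity.exists_dist_le {Γ X ι : Type*} [Group Γ] [MulAction Γ X]
    [PseudoMetricSpace X] [CompactSpace X] [Fintype ι]
    {𝒜 : Set (Γ × (ι → Set X))} (hfin : 𝒜.Finite) (h : PosIndepDensity 𝒜) (i₀ : ι)
    {ε : ℝ} (hε : 0 < ε) :
    ∃ 𝒜' : Set (Γ × (ι → Set X)), 𝒜'.Finite ∧ PosIndepDensity 𝒜' ∧
      ∀ L' ∈ 𝒜', (∃ L ∈ 𝒜, ∀ i, L'.2 i ⊆ L.2 i) ∧
        ∀ x ∈ L'.2 i₀, ∀ y ∈ L'.2 i₀, dist x y ≤ ε := by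
  classical
  have : Nonempty ι := ⟨i₀⟩
  obtain ⟨C, -, hCfin, hC⟩ :=
    (isCompact_univ : IsCompact (Set.univ : Set X)).finite_cover_balls (half_pos hε)
  have hcol : ∀ x : X, ∃ m : C, dist x m < ε / 2 := by
    intro x
    obtain ⟨m, hm, hx⟩ := Set.mem_iUnion₂.mp (hC (Set.mem_univ x))
    exact ⟨⟨m, hm⟩, hx⟩
  choose col hcol using hcol
  have : Fintype C := hCfin.fintype
  let mk : (Γ × (ι → Set X)) × C → Γ × (ι → Set X) := fun t =>
    (t.1.1, fun i => if i = i₀ then t.1.2 i ∩ {x | col x = t.2} else t.1.2 i)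
  refine ⟨mk '' (𝒜 ×ˢ Set.univ), (hfin.prod Set.finite_univ).image _, ?_, ?_⟩
  · obtain ⟨c, hc, hdens⟩ := h
    have hCne : Nonempty C := by
      obtain ⟨J, -, -, ω, -, hx⟩ := hdens ∅
      obtain ⟨x, -⟩ := hx fun _ => i₀
      exact ⟨col x⟩
    set M := (Fintype.card C : ℝ) with hMdef
    have hM : 1 ≤ M := by rw [hMdef]; exact_mod_cast Fintype.card_pos
    obtain ⟨q, hq, hsh⟩ := exists_shattered_of_pow_le_card (ι := ι) (ε := 1 / M) (by positivity)
      (by rw [div_le_one (by positivity)]; exact hM)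
    refine ⟨c / q, by positivity, fun F => ?_⟩
    obtain ⟨J, hJF, hJ, ω, hω, hx⟩ := hdens F
    choose pt hpt using hx
    set n := J.card
    let e : J ≃ Fin n := J.equivFin
    let ext : (Fin n → ι) → Γ → ι := fun σ s => if hs : s ∈ J then σ (e ⟨s, hs⟩) else i₀
    have hext : ∀ σ i, ext σ (e.symm i) = σ i := by
      intro σ i
      simp [ext]
    let cl : (Fin n → ι) → Fin n → C := fun σ i => col (((ω (e.symm i)).1 * e.symm i) • pt (ext σ))
    let T : (Fin n → C) → Finset (Fin n → ι) := fun m => {σ | ∀ i, σ i = i₀ → cl σ i = m i}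
    have hT : ∃ m, ((Fintype.card ι : ℝ) - 1 + 1 / M) ^ n ≤ (T m).card := by
      by_contra! hlt
      have hsum : ∑ m, ((T m).card : ℝ) = (((Fintype.card ι : ℝ) - 1) * M + 1) ^ n := by
        have h1 : ∑ m, (T m).card =
            ∑ σ : Fin n → ι, #{m : Fin n → C | ∀ i, σ i = i₀ → cl σ i = m i} := by
          simp only [T, card_filter]
          exact sum_comm
        have h2 : ∀ σ : Fin n → ι, #{m : Fin n → C | ∀ i, σ i = i₀ → cl σ i = m i} =
            ∏ i, if σ i = i₀ then 1 else Fintype.card C := by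
          intro σ
          have : ({m : Fin n → C | ∀ i, σ i = i₀ → cl σ i = m i} : Finset _) =
              Fintype.piFinset fun i => if σ i = i₀ then {cl σ i} else univ := by
            ext m
            simp only [mem_filter, mem_univ, true_and, Fintype.mem_piFinset]
            refine forall_congr' fun i => ?_
            split_ifs with hi <;> simp [hi, eq_comm]
          rw [this, Fintype.card_piFinset]
          refine prod_congr rfl fun i _ => ?_
          split_ifs <;> simp
        have h3 : ∑ i : ι, (if i = i₀ then 1 else Fintype.card C) =
            1 + (Fintype.card ι - 1) * Fintype.card C := by
          rw [← add_sum_erase _ _ (mem_univ i₀), if_pos rfl,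
            sum_congr rfl (g := fun _ => Fintype.card C)
              fun i hi => if_neg (ne_of_mem_erase hi)]
          simp [card_erase_of_mem]
        have h4 : ∑ m, (T m).card = (1 + (Fintype.card ι - 1) * Fintype.card C) ^ n := by
          rw [h1, sum_congr rfl fun σ _ => h2 σ, ← h3, Fintype.sum_pow]
        have h5 := congrArg (Nat.cast (R := ℝ)) h4
        push_cast [Nat.cast_sub (Fintype.card_pos (α := ι))] at h5
        rw [h5, hMdef]
        ring
      have hlt' : ∑ m, ((T m).card : ℝ) <
          ∑ _m : Fin n → C, ((Fintype.card ι : ℝ) - 1 + 1 / M) ^ n :=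
        sum_lt_sum_of_nonempty univ_nonempty fun m _ => hlt m
      rw [hsum, sum_const, card_univ, Fintype.card_fun, Fintype.card_fin, nsmul_eq_mul,
        Nat.cast_pow, ← mul_pow] at hlt'
      refine lt_irrefl _ (hlt'.trans_eq ?_)
      rw [← hMdef]
      congr 1
      field_simp
    obtain ⟨m, hm⟩ := hT
    obtain ⟨W, hW, hWc⟩ := hsh n (T m) hm
    refine ⟨W.image fun i => (e.symm i : Γ), ?_, ?_,
      fun s => if hs : s ∈ J then mk (ω s, m (e ⟨s, hs⟩)) else ω s, ?_, ?_⟩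
    · intro s hs
      obtain ⟨i, -, rfl⟩ := mem_image.mp hs
      exact hJF (e.symm i).2
    · have hinj : Function.Injective fun i => (e.symm i : Γ) :=
        Subtype.val_injective.comp e.symm.injective
      rw [card_image_of_injective _ hinj, div_mul_eq_mul_div, div_le_iff₀ (by positivity),
        mul_comm (W.card : ℝ)]
      exact hJ.trans (by exact_mod_cast hWc)
    · intro s hs
      obtain ⟨i, -, rfl⟩ := mem_image.mp hs
      simp only [dif_pos (e.symm i).2]
      exact ⟨_, ⟨hω _ (e.symm i).2, Set.mem_univ _⟩, rfl⟩
    · intro τ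
      obtain ⟨σ, hσ, hστ⟩ := hW fun i => τ (e.symm i)
      refine ⟨pt (ext σ), fun s hs => ?_⟩
      obtain ⟨i, hi, rfl⟩ := mem_image.mp hs
      have h1 := hpt (ext σ) _ (e.symm i).2
      rw [hext, hστ i hi] at h1
      simp only [dif_pos (e.symm i).2, mk, Subtype.coe_eta, Equiv.apply_symm_apply]
      split_ifs with h0
      · exact ⟨h1, (mem_filter.mp hσ).2 i ((hστ i hi).trans h0)⟩
      · exact h1
  · rintro _ ⟨⟨L, m⟩, ⟨hL, -⟩, rfl⟩
    refine ⟨⟨L, hL, fun i => ?_⟩, ?_⟩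
    · simp only [mk]
      split_ifs
      · exact Set.inter_subset_left
      · exact subset_rfl
    · intro x hx y hy
      simp only [mk, if_true] at hx hy
      have h1 := hcol x
      have h2 := hcol y
      rw [hx.2] at h1
      rw [hy.2] at h2
      have := dist_triangle_right x y (m : X)
      linarith

theorem coverNum_jointCover_le {Γ X κ : Type*} [Group Γ] [MulAction Γ X] {F : Finset Γ}
    {𝒰 : Finset (Set X)} (𝒲 : Finset κ) (w : κ → Γ → Set X) (hw : ∀ k ∈ 𝒲, ∀ s ∈ F, w k s ∈ 𝒰)
    (hcov : ∀ x : X, ∃ k ∈ 𝒲, ∀ s ∈ F, s • x ∈ w k s) :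
    coverNum (jointCover F 𝒰) ≤ 𝒲.card := by
  classical
  let 𝒱 : Finset (Set X) := 𝒲.image fun k => ⋂ s : Γ, ⋂ _ : s ∈ F, (fun x : X => s • x) ⁻¹' w k s
  suffices h : 𝒱 ⊆ jointCover F 𝒰 ∧ ⋃₀ (𝒱 : Set (Set X)) = Set.univ by
    refine le_trans (Nat.sInf_le ?_) (Finset.card_image_le : 𝒱.card ≤ 𝒲.card)
    exact ⟨𝒱, h.1, h.2, rfl⟩
  constructor
  · intro V hV
    obtain ⟨k, hk, rfl⟩ := Finset.mem_image.mp hV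
    refine Finset.mem_image.mpr ⟨fun s _ => w k s, ?_, rfl⟩
    rw [Finset.mem_pi]
    exact hw k hk
  · refine Set.eq_univ_of_forall fun x => ?_
    obtain ⟨k, hk, hx⟩ := hcov x
    refine ⟨_, Finset.mem_coe.mpr (Finset.mem_image_of_mem _ hk), ?_⟩
    simpa using hx

theorem exists_exp_le_coverNum_of_naiveEntropy_pos {Γ X : Type*} [Group Γ] [TopologicalSpace X]
    [MulAction Γ X] (h : 0 < naiveEntropy Γ X) :
    ∃ 𝒰 : Finset (Set X), IsFinOpenCover 𝒰 ∧ ∃ a : ℝ, 0 < a ∧ ∀ F : Finset Γ, F.Nonempty →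
      Real.exp (a * F.card) ≤ coverNum (jointCover F 𝒰) := by
  obtain ⟨⟨𝒰, h𝒰⟩, h⟩ := lt_iSup_iff.mp h
  refine ⟨𝒰, h𝒰, ?_⟩
  set b : ℝ≥0∞ := ⨅ F : {F : Finset Γ // F.Nonempty},
    ENNReal.ofReal (Real.log (coverNum (jointCover F.1 𝒰) : ℝ) / (F.1.card : ℝ))
  have hle : ∀ F : Finset Γ, F.Nonempty →
      b ≤ ENNReal.ofReal (Real.log (coverNum (jointCover F 𝒰) : ℝ) / (F.card : ℝ)) :=
    fun F hF => iInf_le_of_le ⟨F, hF⟩ le_rfl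
  have htop : b ≠ ⊤ := ne_top_of_le_ne_top ENNReal.ofReal_ne_top
    (hle {1} (Finset.singleton_nonempty _))
  have ha : 0 < b.toReal := ENNReal.toReal_pos h.ne' htop
  refine ⟨b.toReal, ha, fun F hF => ?_⟩
  have hF0 : (0 : ℝ) < F.card := by exact_mod_cast Finset.card_pos.mpr hF
  have h1 := ENNReal.toReal_le_of_le_ofReal
    (div_nonneg (Real.log_natCast_nonneg _) hF0.le) (hle F hF)
  rw [le_div_iff₀ hF0] at h1
  have h2 : (0 : ℝ) < coverNum (jointCover F 𝒰) := by
    rw [Nat.cast_pos, Nat.pos_iff_ne_zero]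
    intro h0
    rw [h0] at h1
    simp only [Nat.cast_zero, Real.log_zero] at h1
    exact absurd h1 (not_le.mpr (mul_pos ha hF0))
  exact (Real.le_log_iff_exp_le h2).mp h1

open Finset in
/-- Positive naive entropy yields pairs of separated sets with positive independence density. -/
theorem exists_posIndepDensity_of_naiveEntropy_pos {Γ X : Type*} [Group Γ] [PseudoMetricSpace X]
    [CompactSpace X] [MulAction Γ X] (h : 0 < naiveEntropy Γ X) :
    ∃ δ : ℝ, 0 < δ ∧ ∃ 𝒜 : Set (Γ × (Bool → Set X)), 𝒜.Finite ∧ PosIndepDensity 𝒜 ∧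
      ∀ L ∈ 𝒜, ∀ x ∈ L.2 false, ∀ y ∈ L.2 true, δ ≤ dist x y := by
  classical
  obtain ⟨𝒰, ⟨hopen, hcov⟩, a, ha, hN⟩ := exists_exp_le_coverNum_of_naiveEntropy_pos h
  obtain ⟨δ, hδ, hball⟩ := lebesgue_number_lemma_of_metric_sUnion
    (isCompact_univ : IsCompact (Set.univ : Set X)) (c := (𝒰 : Set (Set X)))
    (fun U hU => hopen U hU) hcov.ge
  have hX : Nonempty X := by
    by_contra hX
    rw [not_nonempty_iff] at hX
    have h1 := hN {1} (singleton_nonempty _)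
    have h2 := coverNum_jointCover_le (Γ := Γ) (F := {1}) (𝒰 := 𝒰) (∅ : Finset ℕ)
      (fun _ _ => ∅) (by simp) (fun x => hX.elim x)
    rw [card_empty, Nat.le_zero] at h2
    rw [h2, Nat.cast_zero] at h1
    exact absurd h1 (not_le.mpr (Real.exp_pos _))
  obtain ⟨x₀⟩ := hX
  obtain ⟨U₀, hU₀, -⟩ := hball x₀ (Set.mem_univ _)
  have hcard : (0 : ℝ) < #𝒰 := by exact_mod_cast card_pos.mpr ⟨U₀, hU₀⟩
  let V : Set X → Bool → Set X := fun U b => cond b Uᶜ {x | Metric.ball x δ ⊆ U}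
  have hVsub : ∀ U x, x ∈ V U false → x ∈ U := fun U x hx => hx (Metric.mem_ball_self hδ)
  obtain ⟨q, hq, hsh⟩ := exists_partial_shattered_or_few_completions
    (h := a / (2 * #𝒰)) (by positivity)
  refine ⟨δ, hδ, (fun U => (1, V U)) '' (𝒰 : Set (Set X)), 𝒰.finite_toSet.image _,
    ⟨1 / q, by positivity, fun F => ?_⟩, ?_⟩
  · rcases F.eq_empty_or_nonempty with rfl | hF
    · exact ⟨∅, by simp, by simp, fun _ => (1, fun _ => ∅), by simp, fun _ => ⟨x₀, by simp⟩⟩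
    let e : F ≃ Fin #F := F.equivFin
    let code : Set X → X → Fin #F → Option Bool := fun U x i =>
      if (e.symm i : Γ) • x ∈ V U false then some false
      else if (e.symm i : Γ) • x ∈ V U true then some true else none
    have hcode : ∀ U x i b, code U x i = some b → (e.symm i : Γ) • x ∈ V U b := by
      intro U x i b hb
      simp only [code] at hb
      split_ifs at hb with h1 h2 <;> simp only [Option.some.injEq] at hb <;> subst hb <;> assumption
    by_cases hW : ∃ U ∈ 𝒰, ∃ W ∈ partialShatterer (Set.range (code U)), #F ≤ q * #W
    · obtain ⟨U, hU, W, hW, hWc⟩ := hW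
      rw [mem_partialShatterer] at hW
      have hinj : Function.Injective fun i => (e.symm i : Γ) :=
        Subtype.val_injective.comp e.symm.injective
      refine ⟨W.image fun i => (e.symm i : Γ), ?_, ?_, fun _ => (1, V U),
        fun _ _ => ⟨U, hU, rfl⟩, fun σ => ?_⟩
      · intro s hs
        obtain ⟨i, -, rfl⟩ := mem_image.mp hs
        exact (e.symm i).2
      · rw [card_image_of_injective _ hinj, div_mul_eq_mul_div, div_le_iff₀ (by positivity),
          one_mul, mul_comm (#W : ℝ)]
        exact_mod_cast hWc
      · obtain ⟨_, ⟨x, rfl⟩, hx⟩ := hW fun i => σ (e.symm i)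
        refine ⟨x, fun s hs => ?_⟩
        obtain ⟨i, hi, rfl⟩ := mem_image.mp hs
        simpa using hcode U x i _ (hx i hi)
    · exfalso
      have hfew : ∀ U : 𝒰, ∃ 𝒲 : Finset (Fin #F → Bool), (∀ σ ∈ Set.range (code U), ∃ w ∈ 𝒲,
          ∀ i b, σ i = some b → w i = b) ∧ (#𝒲 : ℝ) ≤ Real.exp (a / (2 * #𝒰) * #F) := fun U =>
        (hsh _ _).resolve_left fun ⟨W, h1, h2⟩ => hW ⟨U, U.2, W, h1, h2⟩
      choose 𝒲 h𝒲 h𝒲c using hfew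
      let w : (𝒰 → Fin #F → Bool) → Γ → Set X := fun k s =>
        if hs : s ∈ F then
          if hU : ∃ U, k U (e ⟨s, hs⟩) = false then (hU.choose : Set X) else U₀
        else U₀
      have hle := coverNum_jointCover_le (F := F) (𝒰 := 𝒰) (Fintype.piFinset 𝒲) w ?_ ?_
      · rw [Fintype.card_piFinset] at hle
        have h1 : ((∏ U, #(𝒲 U) : ℕ) : ℝ) ≤ Real.exp (a / (2 * #𝒰) * #F) ^ #𝒰 := by
          push_cast
          refine (prod_le_prod (fun _ _ => Nat.cast_nonneg _) fun U _ => h𝒲c U).trans_eq ?_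
          simp
        have h2 : Real.exp (a * #F) ≤ Real.exp (a / (2 * #𝒰) * #F) ^ #𝒰 :=
          (hN F hF).trans ((Nat.cast_le.mpr hle).trans h1)
        rw [← Real.exp_nat_mul, Real.exp_le_exp] at h2
        have h3 : (#𝒰 : ℝ) * (a / (2 * #𝒰) * #F) = a * #F / 2 := by
          field_simp
        have h4 : 0 < a * #F := mul_pos ha (by exact_mod_cast card_pos.mpr hF)
        linarith
      · intro k _ s hs
        simp only [w, dif_pos hs]
        split_ifs with hU
        · exact hU.choose.2
        · exact hU₀
      · intro x
        choose k hk hkx using fun U : 𝒰 => h𝒲 U (code U x) ⟨x, rfl⟩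
        refine ⟨k, Fintype.mem_piFinset.mpr hk, fun s hs => ?_⟩
        obtain ⟨U, hU, hUx⟩ := hball (s • x) (Set.mem_univ _)
        have hex : ∃ U, k U (e ⟨s, hs⟩) = false := by
          refine ⟨⟨U, hU⟩, hkx _ _ _ ?_⟩
          have : s • x ∈ V U false := hUx
          simp [code, this]
        simp only [w, dif_pos hs, dif_pos hex]
        set U' := hex.choose
        have hU' : k U' (e ⟨s, hs⟩) = false := hex.choose_spec
        by_contra hnot
        have hf : s • x ∉ V U' false := fun hf => hnot (hVsub _ _ hf)
        have ht : s • x ∈ V U' true := hnot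
        have := hkx U' (e ⟨s, hs⟩) true (by simp [code, hf, ht])
        rw [hU'] at this
        exact Bool.false_ne_true this
  · rintro _ ⟨U, -, rfl⟩ x hx y hy
    by_contra! hlt
    exact hy (hx (by rwa [Metric.mem_ball, dist_comm]))

/-- König's lemma for a sequence of finite types in which every element has a predecessor. -/
theorem exists_seq_rel_of_finite {A : ℕ → Type*} [∀ n, Finite (A n)] [∀ n, Nonempty (A n)]
    (R : ∀ n, A n → A (n + 1) → Prop) (hR : ∀ n b, ∃ a, R n a b) :
    ∃ f : ∀ n, A n, ∀ n, R n (f n) (f (n + 1)) := by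
  let _ : ∀ n, TopologicalSpace (A n) := fun _ => ⊥
  have : ∀ n, DiscreteTopology (A n) := fun _ => ⟨rfl⟩
  let T : ℕ → Set (∀ n, A n) := fun n => {f | ∀ m < n, R m (f m) (f (m + 1))}
  have hclosed : ∀ n, IsClosed (T n) := by
    intro n
    simp only [T, Set.ofPred_forall]
    refine isClosed_iInter fun m => isClosed_iInter fun _ => ?_
    exact (isClosed_discrete {p : A m × A (m + 1) | R m p.1 p.2}).preimage
      ((continuous_apply m).prodMk (continuous_apply (m + 1)))
  have hext : ∀ n (a : A n), ∃ f ∈ T n, f n = a := by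
    intro n
    induction n with
    | zero =>
      intro a
      exact ⟨Function.update (fun _ => Classical.arbitrary _) 0 a, by simp [T], by simp⟩
    | succ n ih =>
      intro b
      obtain ⟨a, hab⟩ := hR n b
      obtain ⟨f, hf, hfa⟩ := ih a
      refine ⟨Function.update f (n + 1) b, fun m hm => ?_, by simp⟩
      rw [Function.update_of_ne (by omega : m ≠ n + 1)]
      rcases (Nat.lt_succ_iff_lt_or_eq.mp hm) with hm | rfl
      · rw [Function.update_of_ne (by omega : m + 1 ≠ n + 1)]
        exact hf m hm
      · rwa [Function.update_self, hfa]
  obtain ⟨f, hf⟩ := IsCompact.nonempty_iInter_of_sequence_nonempty_isCompact_isClosed T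
    (fun n f hf m hm => hf m (hm.trans n.lt_succ_self))
    (fun n => let ⟨f, hf, _⟩ := hext n (Classical.arbitrary _); ⟨f, hf⟩)
    (hclosed 0).isCompact hclosed
  exact ⟨f, fun n => Set.mem_iInter.mp hf (n + 1) n n.lt_succ_self⟩

/-- A finite family with positive independence density, whose labels are tuples of nonempty sets
indexed by binary words, the sets of the two constant words being `δ`-separated. -/
structure IsSeparatedFamily {Γ X : Type*} [Group Γ] [Dist X] [MulAction Γ X] {n : ℕ} (δ : ℝ)
    (𝒜 : Set (Γ × ((Fin (n + 1) → Bool) → Set X))) : Prop where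
  finite : 𝒜.Finite
  posIndepDensity : PosIndepDensity 𝒜
  nonempty : ∀ L ∈ 𝒜, ∀ τ, (L.2 τ).Nonempty
  le_dist : ∀ L ∈ 𝒜, ∀ x ∈ L.2 fun _ => false, ∀ y ∈ L.2 fun _ => true, δ ≤ dist x y

/-- `D` splits each set of `C` in two by the position of `g • x` for some `g ∉ Φ`: in a set of
diameter at most `ε` for the new letter `false`, and at distance at least `δ` from it for `true`. -/
def IsSplitting {Γ X : Type*} [Group Γ] [Dist X] [MulAction Γ X] {n : ℕ} (δ ε : ℝ) (Φ : Set Γ)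
    (C : (Fin (n + 1) → Bool) → Set X) (D : (Fin (n + 2) → Bool) → Set X) : Prop :=
  ∃ g ∉ Φ, ∃ B : Bool → Set X, (∀ x ∈ B false, ∀ y ∈ B false, dist x y ≤ ε) ∧
    (∀ x ∈ B false, ∀ y ∈ B true, δ ≤ dist x y) ∧
    ∀ τ, D τ ⊆ C (Fin.init τ) ∩ {x | g • x ∈ B (τ (Fin.last _))}

section

variable {Γ X : Type*} [Group Γ] [Infinite Γ] [PseudoMetricSpace X] [CompactSpace X]
  [MulAction Γ X] {δ : ℝ}

theorem IsSeparatedFamily.exists_splitting {n : ℕ}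
    {𝒜 : Set (Γ × ((Fin (n + 1) → Bool) → Set X))} (h : IsSeparatedFamily δ 𝒜) {ε : ℝ}
    (hε : 0 < ε) {Φ : Set Γ} (hΦ : Φ.Finite) :
    ∃ 𝒜' : Set (Γ × ((Fin (n + 2) → Bool) → Set X)), IsSeparatedFamily δ 𝒜' ∧
      ∀ L' ∈ 𝒜', ∃ L ∈ 𝒜, IsSplitting δ ε Φ L.2 L'.2 := by
  obtain ⟨𝒜₁, hfin₁, hpos₁, h₁⟩ := h.posIndepDensity.exists_dist_le h.finite (fun _ => false) hε
  obtain ⟨𝒜₂, hfin₂, hpos₂, h₂⟩ := hpos₁.exists_inter hfin₁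
    (Fin.init : (Fin (n + 2) → Bool) → Fin (n + 1) → Bool) (fun τ _ => τ (Fin.last _)) hΦ
  have hsplit : ∀ L' ∈ 𝒜₂, ∃ L ∈ 𝒜, IsSplitting δ ε Φ L.2 L'.2 := by
    intro L' hL'
    obtain ⟨L, hL, M, hM, g, hg, hLM⟩ := h₂ L' hL'
    obtain ⟨⟨L₀, hL₀, hLL₀⟩, -⟩ := h₁ L hL
    obtain ⟨⟨M₀, hM₀, hMM₀⟩, hdist⟩ := h₁ M hM
    refine ⟨L₀, hL₀, g, hg, fun b => M.2 fun _ => b, hdist,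
      fun x hx y hy => h.le_dist M₀ hM₀ x (hMM₀ _ hx) y (hMM₀ _ hy), fun τ => ?_⟩
    rw [hLM]
    exact Set.inter_subset_inter_left _ (hLL₀ _)
  refine ⟨_, ⟨hfin₂.subset (Set.sep_subset _ _), hpos₂.restrict_nonempty, fun L hL => hL.2, ?_⟩,
    fun L hL => hsplit L hL.1⟩
  intro L' hL' x hx y hy
  obtain ⟨L, hL, g, -, B, -, -, hsub⟩ := hsplit L' hL'.1
  exact h.le_dist L hL x (hsub _ hx).1 y (hsub _ hy).1

theorem exists_isSeparatedFamily_of_naiveEntropy_pos (h : 0 < naiveEntropy Γ X) :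
    ∃ δ : ℝ, 0 < δ ∧ ∃ 𝒜 : Set (Γ × ((Fin 1 → Bool) → Set X)), IsSeparatedFamily δ 𝒜 := by
  obtain ⟨δ, hδ, 𝒜, hfin, hpos, hsep⟩ := exists_posIndepDensity_of_naiveEntropy_pos h
  obtain ⟨𝒜', hfin', hpos', h'⟩ := hpos.exists_inter hfin
    (fun τ : Fin 1 → Bool => τ 0) (fun τ => τ 0) Set.finite_empty
  refine ⟨δ, hδ, _, hfin'.subset (Set.sep_subset _ _), hpos'.restrict_nonempty,
    fun L hL => hL.2, ?_⟩
  intro L' hL' x hx y hy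
  obtain ⟨L, hL, M, -, g, -, hLM⟩ := h' L' hL'.1
  rw [hLM] at hx hy
  exact hsep L hL x hx.1 y hy.1

theorem IsSeparatedFamily.exists_splitting_seq {𝒜 : Set (Γ × ((Fin 1 → Bool) → Set X))}
    (h : IsSeparatedFamily δ 𝒜) {ε : ℕ → ℝ} (hε : ∀ n, 0 < ε n) {Φ : ℕ → Set Γ}
    (hΦ : ∀ n, (Φ n).Finite) :
    ∃ C : ∀ n : ℕ, (Fin (n + 1) → Bool) → Set X, (∀ n τ, (C n τ).Nonempty) ∧
      ∀ n, IsSplitting δ (ε n) (Φ n) (C n) (C (n + 1)) := by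
  choose next hnext hsplit using fun (n : ℕ)
    (𝒜 : {𝒜 : Set (Γ × ((Fin (n + 1) → Bool) → Set X)) // IsSeparatedFamily δ 𝒜}) =>
    𝒜.2.exists_splitting (hε n) (hΦ n)
  let 𝔉 : ∀ n, {𝒜 : Set (Γ × ((Fin (n + 1) → Bool) → Set X)) // IsSeparatedFamily δ 𝒜} :=
    fun n => Nat.rec ⟨𝒜, h⟩ (fun n 𝒜 => ⟨next n 𝒜, hnext n 𝒜⟩) n
  have : ∀ n, Finite (𝔉 n).1 := fun n => (𝔉 n).2.finite
  have : ∀ n, Nonempty (𝔉 n).1 := fun n => (𝔉 n).2.posIndepDensity.nonempty.to_subtype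
  obtain ⟨L, hL⟩ := exists_seq_rel_of_finite
    (fun n (L : (𝔉 n).1) (L' : (𝔉 (n + 1)).1) => IsSplitting δ (ε n) (Φ n) L.1.2 L'.1.2)
    (fun n L' => let ⟨L, hL, h⟩ := hsplit n (𝔉 n) L'.1 L'.2; ⟨⟨L, hL⟩, h⟩)
  exact ⟨fun n => (L n).1.2, fun n => (𝔉 n).2.nonempty _ (L n).2, hL⟩

end

theorem exists_branch_points {Γ X : Type*} [Group Γ] [PseudoMetricSpace X] [CompactSpace X]
    [MulAction Γ X] [ContinuousConstSMul Γ X] {δ : ℝ} {ε : ℕ → ℝ} {Φ : ℕ → Set Γ}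
    {C : ∀ n : ℕ, (Fin (n + 1) → Bool) → Set X} (hC : ∀ n τ, (C n τ).Nonempty)
    (hsplit : ∀ n, IsSplitting δ (ε n) (Φ n) (C n) (C (n + 1))) :
    ∃ (g : ℕ → Γ) (x : (ℕ → Bool) → X), ∀ n, g n ∉ Φ n ∧ ∀ ξ η : ℕ → Bool, ξ n = false →
      (η n = false → dist (g n • x ξ) (g n • x η) ≤ ε n) ∧
      (η n = true → δ ≤ dist (g n • x ξ) (g n • x η)) := by
  choose g hg B hε hδ hsub using hsplit
  have hx : ∀ ξ : ℕ → Bool, ∃ x, ∀ n, g n • x ∈ closure (B n (ξ n)) := by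
    intro ξ
    let w : ∀ n, Fin (n + 1) → Bool := fun n i => Nat.casesOn i.1 false ξ
    have hw : ∀ n, Fin.init (w (n + 1)) = w n := fun n => rfl
    obtain ⟨x, hx⟩ := IsCompact.nonempty_iInter_of_sequence_nonempty_isCompact_isClosed
      (fun n => closure (C n (w n)))
      (fun n => closure_mono fun x hx => by simpa only [hw] using (hsub n _ hx).1)
      (fun n => (hC n _).closure) isClosed_closure.isCompact (fun _ => isClosed_closure)
    rw [Set.mem_iInter] at hx
    refine ⟨x, fun n => ?_⟩
    exact map_mem_closure (continuous_const_smul (g n)) (hx (n + 1)) fun y hy => (hsub n _ hy).2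
  choose x hx using hx
  refine ⟨g, x, fun n => ⟨hg n, fun ξ η hξ => ⟨fun hη => ?_, fun hη => ?_⟩⟩⟩
  · have h1 := hx ξ n
    have h2 := hx η n
    rw [hξ] at h1
    rw [hη] at h2
    have := map_mem_closure₂ (s := B n false) (t := B n false) (u := Set.Iic (ε n))
      continuous_dist h1 h2 (hε n)
    rwa [isClosed_Iic.closure_eq] at this
  · have h1 := hx ξ n
    have h2 := hx η n
    rw [hξ] at h1
    rw [hη] at h2
    have := map_mem_closure₂ (s := B n false) (t := B n true) (u := Set.Ici δ)
      continuous_dist h1 h2 (hδ n)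
    rwa [isClosed_Ici.closure_eq] at this

/-- If a countably infinite group `Γ` acts by homeomorphisms on a compact metrizable space
`X` (with compatible metric given by the `MetricSpace` structure) with positive naive
topological entropy, then the action is Li–Yorke chaotic: there is an uncountable set
`Y ⊆ X` such that for all distinct `x, y ∈ Y`,
`limsup_{Γ ∋ s → ∞} ρ(sx, sy) > 0` and `liminf_{Γ ∋ s → ∞} ρ(sx, sy) = 0`,
the limits being taken along the cofinite filter on `Γ`. -/
theorem positive_naive_entropy_implies_LiYorke_chaotic
    {Γ : Type*} [Group Γ] [Countable Γ] [Infinite Γ]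
    {X : Type*} [MetricSpace X] [CompactSpace X]
    [MulAction Γ X] [ContinuousConstSMul Γ X]
    (h : 0 < naiveEntropy Γ X) :
    ∃ Y : Set X, ¬ Y.Countable ∧
      ∀ x ∈ Y, ∀ y ∈ Y, x ≠ y →
        0 < Filter.limsup (fun s : Γ => dist (s • x) (s • y)) Filter.cofinite ∧
        Filter.liminf (fun s : Γ => dist (s • x) (s • y)) Filter.cofinite = 0 := by
  obtain ⟨code, hcode⟩ := exists_injective_nat Γ
  obtain ⟨δ, hδ, 𝒜, h𝒜⟩ := exists_isSeparatedFamily_of_naiveEntropy_pos h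
  obtain ⟨C, hC, hsplit⟩ := h𝒜.exists_splitting_seq (ε := fun n => 1 / ((n : ℝ) + 1))
    (fun n => by positivity) (Φ := fun n => code ⁻¹' Set.Iic n)
    (fun n => (Set.finite_Iic n).preimage hcode.injOn)
  obtain ⟨g, x, hgx⟩ := exists_branch_points hC hsplit
  have hg : Filter.Tendsto g Filter.atTop Filter.cofinite := by
    rw [← hcode.comap_cofinite_eq, Nat.cofinite_eq_atTop, Filter.tendsto_comap_iff]
    exact Filter.tendsto_atTop_mono (fun n => (not_le.mp (hgx n).1).le) Filter.tendsto_id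
  let word : (ℕ → Bool) → ℕ → Bool := fun ζ n => Nat.casesOn (Nat.unpair n).1 false ζ
  have hfalse : ∀ ζ b, word ζ (Nat.pair 0 b) = false := by simp [word]
  have hword : ∀ ζ a b, word ζ (Nat.pair (a + 1) b) = ζ a := by simp [word]
  have hsep : ∀ ζ ζ' : ℕ → Bool, ζ ≠ ζ' →
      ∃ᶠ s : Γ in Filter.cofinite, δ ≤ dist (s • x (word ζ)) (s • x (word ζ')) := by
    intro ζ ζ' hne
    obtain ⟨a, ha⟩ := Function.ne_iff.mp hne
    refine hg.frequently (Filter.frequently_atTop.mpr fun N =>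
      ⟨Nat.pair (a + 1) N, Nat.right_le_pair _ _, ?_⟩)
    rcases hb : ζ a with _ | _
    · exact ((hgx _).2 _ _ ((hword ζ a N).trans hb)).2
        ((hword ζ' a N).trans (Bool.eq_true_of_not_eq_false fun h => ha (hb.trans h.symm)))
    · rw [dist_comm]
      exact ((hgx _).2 _ _ ((hword ζ' a N).trans
        (Bool.eq_false_of_not_eq_true fun h => ha (hb.trans h.symm)))).2 ((hword ζ a N).trans hb)
  have hclose : ∀ ζ ζ' : ℕ → Bool, ∀ r > 0,
      ∃ᶠ s : Γ in Filter.cofinite, dist (s • x (word ζ)) (s • x (word ζ')) ≤ r := by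
    intro ζ ζ' r hr
    obtain ⟨M, hM⟩ := exists_nat_one_div_lt hr
    refine hg.frequently (Filter.frequently_atTop.mpr fun N =>
      ⟨Nat.pair 0 (max M N), (le_max_right _ _).trans (Nat.right_le_pair _ _), ?_⟩)
    refine (((hgx _).2 _ _ (hfalse ζ _)).1 (hfalse ζ' _)).trans (le_trans ?_ hM.le)
    exact Nat.one_div_le_one_div ((le_max_left _ _).trans (Nat.right_le_pair _ _))
  have hinj : Function.Injective fun ζ => x (word ζ) := by
    intro ζ ζ' heq
    by_contra hne
    obtain ⟨s, hs⟩ := (hsep ζ ζ' hne).exists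
    rw [show x (word ζ) = x (word ζ') from heq, dist_self] at hs
    exact hs.not_gt hδ
  refine ⟨Set.range fun ζ => x (word ζ), fun hY => ?_, ?_⟩
  · have hpre := hY.preimage_of_injOn hinj.injOn
    rw [Set.preimage_range, Set.countable_univ_iff] at hpre
    obtain ⟨f, hf⟩ := exists_surjective_nat (ℕ → Bool)
    obtain ⟨n, hn⟩ := hf fun n => !f n n
    exact absurd (congrFun hn n) (by simp)
  rintro _ ⟨ζ, rfl⟩ _ ⟨ζ', rfl⟩ hne
  have hbdd : Filter.IsBoundedUnder (· ≤ ·) Filter.cofinite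
      fun s : Γ => dist (s • x (word ζ)) (s • x (word ζ')) :=
    Filter.isBoundedUnder_of ⟨Metric.diam (Set.univ : Set X), fun s =>
      Metric.dist_le_diam_of_mem isCompact_univ.isBounded (Set.mem_univ _) (Set.mem_univ _)⟩
  have hbdd' : Filter.IsBoundedUnder (· ≥ ·) Filter.cofinite
      fun s : Γ => dist (s • x (word ζ)) (s • x (word ζ')) :=
    Filter.isBoundedUnder_of ⟨0, fun s => dist_nonneg⟩
  refine ⟨hδ.trans_le (Filter.le_limsup_of_frequently_le
    (hsep ζ ζ' fun h => hne (congrArg (fun ζ => x (word ζ)) h)) hbdd), le_antisymm ?_ ?_⟩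
  · exact le_of_forall_pos_le_add fun r hr => by
      simpa using Filter.liminf_le_of_frequently_le (hclose ζ ζ' r hr) hbdd'
  · exact Filter.le_liminf_of_le hbdd.isCoboundedUnder_ge
      (Filter.Eventually.of_forall fun _ => dist_nonneg)
end

section
/- Let Γ be a countably infinite discrete group acting distally on a compact metrizable space X by homeomorphisms. Then the naive topological entropy h^nv(Γ↷X) is zero. -/
open scoped ENNReal NNReal

open scoped Pointwise in
/-- In an infinite group every finite set has arbitrarily many pairwise disjoint translates. -/
lemma exists_finset_card_mul_eq {Γ : Type*} [Group Γ] [Infinite Γ] [DecidableEq Γ]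
    (Q : Finset Γ) (m : ℕ) : ∃ H : Finset Γ, H.card = m ∧ (Q * H).card = Q.card * m := by
  induction m with
  | zero => exact ⟨∅, by simp⟩
  | succ m ih =>
    obtain ⟨H, hH, hQH⟩ := ih
    obtain ⟨h, hh⟩ := Infinite.exists_notMem_finset (Q⁻¹ * (Q * H) ∪ H)
    rw [Finset.mem_union, not_or] at hh
    refine ⟨insert h H, by rw [Finset.card_insert_of_notMem hh.2, hH], ?_⟩
    have hdisj : Disjoint (Q * {h}) (Q * H) := by
      rw [Finset.disjoint_left]
      intro x hx hx'
      obtain ⟨q, hq, y, hy, rfl⟩ := Finset.mem_mul.1 hx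
      rw [Finset.mem_singleton] at hy
      subst hy
      exact hh.1 (Finset.mem_mul.2 ⟨q⁻¹, Finset.inv_mem_inv hq, q * y, hx', by group⟩)
    rw [Finset.insert_eq, Finset.mul_union, Finset.card_union_of_disjoint hdisj, hQH,
      Finset.card_mul_singleton]
    ring

open scoped Pointwise in
/-- There is a sequence of finite sets `Q k`, as large as prescribed, such that each later one is
exactly tiled by right translates of each earlier one. -/
lemma exists_tiling_sequence {Γ : Type*} [Group Γ] [Infinite Γ] [DecidableEq Γ] (M : ℕ → ℕ) :
    ∃ Q : ℕ → Finset Γ, (∀ k, (Q k).Nonempty) ∧ (∀ k, M k ≤ (Q k).card) ∧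
      ∀ k n, k ≤ n → ∃ T : Finset Γ, Q n = Q k * T ∧ (Q k).card * T.card ≤ (Q n).card := by
  choose H hH hQH using fun (Q : Finset Γ) (m : ℕ) => exists_finset_card_mul_eq Q m
  let Q : ℕ → Finset Γ := fun k =>
    Nat.rec (H {1} (M 0 + 1)) (fun k R => R * H R (M (k + 1) + 1)) k
  have hsucc (k : ℕ) : Q (k + 1) = Q k * H (Q k) (M (k + 1) + 1) := rfl
  have hcard (k : ℕ) : (Q (k + 1)).card = (Q k).card * (M (k + 1) + 1) := by
    rw [hsucc, hQH]
  have hzero : (Q 0).card = M 0 + 1 := hH _ _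
  have hpos (k : ℕ) : 0 < (Q k).card := by
    induction k with
    | zero => omega
    | succ k ih => rw [hcard]; positivity
  refine ⟨Q, fun k => Finset.card_pos.1 (hpos k), fun k => ?_, fun k n hkn => ?_⟩
  · cases k with
    | zero => omega
    | succ k => rw [hcard]; nlinarith [hpos k]
  · induction n, hkn using Nat.le_induction with
    | base => exact ⟨1, (mul_one _).symm, by simp⟩
    | succ n _ ih =>
      obtain ⟨T, hT, hc⟩ := ih
      refine ⟨T * H (Q n) (M (n + 1) + 1), by rw [hsucc, ← mul_assoc, ← hT], ?_⟩
      calc (Q k).card * (T * H (Q n) (M (n + 1) + 1)).card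
          ≤ (Q k).card * (T.card * (M (n + 1) + 1)) := by
            gcongr
            exact Finset.card_mul_le.trans_eq (by rw [hH])
        _ = (Q k).card * T.card * (M (n + 1) + 1) := by ring
        _ ≤ (Q n).card * (M (n + 1) + 1) := by gcongr
        _ = _ := (hcard n).symm

/-- If every fibre of `q : X → ι` is contained in a member of `𝒱`, then `N(𝒱) ≤ |ι|`. -/
lemma coverNum_le_card {X ι : Type*} [Fintype ι] (𝒱 : Finset (Set X)) (q : X → ι)
    (h : ∀ x, ∃ V ∈ 𝒱, ∀ y, q y = q x → y ∈ V) : coverNum 𝒱 ≤ Fintype.card ι := by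
  classical
  rcases isEmpty_or_nonempty X with hX | hX
  · refine le_trans (Nat.sInf_le (m := 0) ?_) (Nat.zero_le _)
    refine ⟨∅, Finset.empty_subset _, ?_, rfl⟩
    exact Set.eq_univ_of_forall fun x => isEmptyElim x
  · choose V hV hqV using h
    refine le_trans (Nat.sInf_le ?_)
      (Finset.card_image_le (s := Finset.univ) (f := fun i => V (Function.invFun q i)))
    refine ⟨Finset.univ.image fun i => V (Function.invFun q i), ?_, ?_, rfl⟩
    · intro W hW
      obtain ⟨i, -, rfl⟩ := Finset.mem_image.1 hW
      exact hV _
    · refine Set.eq_univ_of_forall fun x => ⟨V (Function.invFun q (q x)), ?_, ?_⟩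
      · simp
      · exact hqV _ _ (Function.invFun_eq ⟨x, rfl⟩).symm

/-- A set all of whose translates by `F` lie in members of `𝒰` lies in a member of `𝒰^F`. -/
lemma exists_mem_jointCover {Γ X : Type*} [Group Γ] [MulAction Γ X] (F : Finset Γ)
    (𝒰 : Finset (Set X)) (Y : Set X) (h : ∀ s ∈ F, ∃ U ∈ 𝒰, ∀ y ∈ Y, s • y ∈ U) :
    ∃ V ∈ jointCover F 𝒰, Y ⊆ V := by
  classical
  choose U hU hY using h
  refine ⟨⋂ s : Γ, ⋂ hs : s ∈ F, (fun x : X => s • x) ⁻¹' U s hs, ?_, fun y hy => ?_⟩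
  · unfold jointCover
    exact Finset.mem_image.2 ⟨U, Finset.mem_pi.2 hU, rfl⟩
  · exact Set.mem_iInter₂.2 fun s hs => hY s hs y hy

/-- A compact metric space has a finite colouring whose colour classes are small. -/
lemma exists_finite_coloring {X : Type*} [MetricSpace X] [CompactSpace X] {ε : ℝ} (hε : 0 < ε) :
    ∃ (r : ℕ) (p : X → Fin (r + 1)), ∀ x y, p x = p y → dist x y ≤ ε := by
  obtain ⟨t, -, ht, hcov⟩ := finite_cover_balls_of_compact (isCompact_univ (X := X)) (half_pos hε)
  have hx (x : X) : ∃ z : t, dist x z < ε / 2 := by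
    obtain ⟨z, hz, hxz⟩ := Set.mem_iUnion₂.1 (hcov (Set.mem_univ x))
    exact ⟨⟨z, hz⟩, hxz⟩
  choose c hc using hx
  have := ht.fintype
  refine ⟨Fintype.card t, fun x => (Fintype.equivFin t (c x)).castSucc, fun x y hxy => ?_⟩
  have hcc : c x = c y := (Fintype.equivFin t).injective (Fin.castSucc_injective _ hxy)
  have h1 := hc x
  rw [hcc] at h1
  linarith [dist_triangle_right x y (c y : X), hc y]

/-- If `N(𝒰^F)` exceeds the number of cells cut out by the colourings `p k` along the finite sets
`T k`, then two points of a common cell are separated at the scale of a Lebesgue number of `𝒰`. -/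
lemma exists_separated_pair_in_cell {Γ X : Type*} [Group Γ] [MetricSpace X] [MulAction Γ X]
    {𝒰 : Finset (Set X)} {δ : ℝ} (hδ : ∀ x, ∃ U ∈ 𝒰, Metric.ball x δ ⊆ U)
    (F : Finset Γ) {n : ℕ} (T : Fin n → Finset Γ) (r : Fin n → ℕ)
    (p : ∀ k, X → Fin (r k + 1))
    (hlt : ∑ k, ((T k).card : ℝ) * Real.log (r k + 1) <
      Real.log (coverNum (jointCover F 𝒰))) :
    ∃ f ∈ F, ∃ x y : X, δ ≤ dist (f • x) (f • y) ∧
      ∀ k, ∀ t ∈ T k, p k (t • x) = p k (t • y) := by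
  classical
  by_contra! hcon
  let q : X → ∀ k, T k → Fin (r k + 1) := fun x k t => p k ((t : Γ) • x)
  have hle := coverNum_le_card (jointCover F 𝒰) q fun x => by
    obtain ⟨V, hV, hsub⟩ := exists_mem_jointCover F 𝒰 {y | q y = q x} fun f hf => by
      obtain ⟨U, hU, hball⟩ := hδ (f • x)
      refine ⟨U, hU, fun y hy => hball ?_⟩
      by_contra hd
      obtain ⟨k, t, ht, hne⟩ := hcon f hf y x (not_lt.1 hd)
      exact hne (congrFun (congrFun hy k) ⟨t, ht⟩)
    exact ⟨V, hV, fun y hy => hsub hy⟩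
  have hsum : (0 : ℝ) ≤ ∑ k, ((T k).card : ℝ) * Real.log (r k + 1) :=
    Finset.sum_nonneg fun k _ => mul_nonneg (Nat.cast_nonneg _)
      (Real.log_nonneg (by linarith [Nat.cast_nonneg (α := ℝ) (r k)]))
  have hN : 0 < coverNum (jointCover F 𝒰) := by
    rcases Nat.eq_zero_or_pos (coverNum (jointCover F 𝒰)) with h0 | h0
    · rw [h0, Nat.cast_zero, Real.log_zero] at hlt
      linarith
    · exact h0
  have hlog := Real.log_le_log (Nat.cast_pos.2 hN) (Nat.cast_le (α := ℝ).2 hle)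
  have hcard : Real.log (Fintype.card (∀ k, T k → Fin (r k + 1)) : ℝ) =
      ∑ k, ((T k).card : ℝ) * Real.log (r k + 1) := by
    rw [Fintype.card_pi, Nat.cast_prod, Real.log_prod]
    · refine Finset.sum_congr rfl fun k _ => ?_
      simp
    · intro k _
      positivity
  rw [hcard] at hlog
  linarith

/-- If the entropy of a finite open cover along all finite sets is bounded below by `c > 0`, then
the action has a proximal pair of distinct points. -/
lemma exists_proximal_pair {Γ X : Type*} [Group Γ] [Infinite Γ] [MetricSpace X] [CompactSpace X]
    [MulAction Γ X] [ContinuousConstSMul Γ X] {𝒰 : Finset (Set X)} (h𝒰 : IsFinOpenCover 𝒰)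
    {c : ℝ} (hc : 0 < c)
    (hent : ∀ F : Finset Γ, F.Nonempty →
      c * F.card ≤ Real.log (coverNum (jointCover F 𝒰))) :
    ∃ x y : X, x ≠ y ∧ ∀ ε > 0, ∃ s : Γ, dist (s • x) (s • y) < ε := by
  classical
  obtain ⟨δ, hδ, hleb⟩ := lebesgue_number_lemma_of_metric_sUnion (isCompact_univ (X := X))
    h𝒰.1 h𝒰.2.ge
  choose r p hp using fun k : ℕ =>
    exists_finite_coloring (X := X) (Nat.one_div_pos_of_nat (α := ℝ) (n := k))
  choose M hM using fun k : ℕ => exists_nat_ge (Real.log (r k + 1) / (c * (1 / 2) ^ (k + 1)))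
  obtain ⟨Q, hQne, hQM, hQT⟩ := exists_tiling_sequence (Γ := Γ) M
  let C : ℕ → Set (X × X) := fun n => {z | δ ≤ dist z.1 z.2} ∩
    ⋂ k : ℕ, ⋂ _ : k < n, ⋃ g ∈ Q k, {z | dist (g⁻¹ • z.1) (g⁻¹ • z.2) ≤ 1 / ((k : ℝ) + 1)}
  have hclosed (n : ℕ) : IsClosed (C n) := by
    refine (isClosed_le continuous_const continuous_dist).inter ?_
    refine isClosed_iInter fun k => isClosed_iInter fun _ => ?_
    refine (Q k).finite_toSet.isClosed_biUnion fun g _ => isClosed_le ?_ continuous_const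
    exact (continuous_fst.const_smul g⁻¹).dist (continuous_snd.const_smul g⁻¹)
  have hanti (n : ℕ) : C (n + 1) ⊆ C n := by
    refine Set.inter_subset_inter_right _ fun z hz => ?_
    simp only [Set.mem_iInter] at hz ⊢
    exact fun k hk => hz k (hk.trans n.lt_succ_self)
  have hne (n : ℕ) : (C n).Nonempty := by
    choose T hT hTc using fun k : Fin n => hQT k n k.2.le
    have hpos : (0 : ℝ) < (Q n).card := Nat.cast_pos.2 (Finset.card_pos.2 (hQne n))
    obtain ⟨f, hf, x, y, hxy, hcell⟩ := exists_separated_pair_in_cell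
      (fun x => hleb x (Set.mem_univ x)) (Q n) T (fun k => r k) (fun k => p k) (by
        refine lt_of_lt_of_le ?_ (hent (Q n) (hQne n))
        calc ∑ k, ((T k).card : ℝ) * Real.log (r k + 1)
            ≤ ∑ k : Fin n, c * (Q n).card * (1 / 2) ^ ((k : ℕ) + 1) := by
              refine Finset.sum_le_sum fun k _ => ?_
              have h1 := hM k
              rw [div_le_iff₀ (by positivity)] at h1
              have h2 : (M k : ℝ) ≤ (Q k).card := Nat.cast_le.2 (hQM k)
              have h3 : ((Q k).card : ℝ) * (T k).card ≤ (Q n).card := by exact_mod_cast hTc k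
              calc ((T k).card : ℝ) * Real.log (r k + 1)
                  ≤ (T k).card * ((Q k).card * (c * (1 / 2) ^ ((k : ℕ) + 1))) := by
                    gcongr
                    exact h1.trans (by gcongr)
                _ = ((Q k).card * (T k).card) * (c * (1 / 2) ^ ((k : ℕ) + 1)) := by ring
                _ ≤ (Q n).card * (c * (1 / 2) ^ ((k : ℕ) + 1)) := by gcongr
                _ = _ := by ring
          _ = c * (Q n).card * (1 - (1 / 2) ^ n) := by
              rw [← Finset.mul_sum, Fin.sum_univ_eq_sum_range (fun k => (1 / 2 : ℝ) ^ (k + 1))]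
              simp only [pow_succ]
              rw [← Finset.sum_mul, geom_sum_eq (by norm_num)]
              ring
          _ < c * (Q n).card := by
              have h1 : (0 : ℝ) < (1 / 2) ^ n := by positivity
              exact mul_lt_of_lt_one_right (by positivity) (by linarith))
    refine ⟨(f • x, f • y), hxy, ?_⟩
    simp only [Set.mem_iInter, Set.mem_iUnion]
    intro k hk
    rw [hT ⟨k, hk⟩] at hf
    obtain ⟨g, hg, t, ht, rfl⟩ := Finset.mem_mul.1 hf
    refine ⟨g, hg, ?_⟩
    simpa [mul_smul] using hp k _ _ (hcell ⟨k, hk⟩ t ht)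
  obtain ⟨⟨x, y⟩, hz⟩ := IsCompact.nonempty_iInter_of_sequence_nonempty_isCompact_isClosed
    C hanti hne (hclosed 0).isCompact hclosed
  rw [Set.mem_iInter] at hz
  refine ⟨x, y, dist_pos.1 (hδ.trans_le (hz 0).1), fun ε hε => ?_⟩
  obtain ⟨k, hk⟩ := exists_nat_one_div_lt hε
  have h := (hz (k + 1)).2
  simp only [Set.mem_iInter, Set.mem_iUnion] at h
  obtain ⟨g, -, hg⟩ := h k k.lt_succ_self
  exact ⟨g⁻¹, hg.trans_lt hk⟩

/-- If a countably infinite group `Γ` acts distally by homeomorphisms on a compact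
metrizable space `X` (with compatible metric given by the `MetricSpace` structure),
i.e. `inf_{s ∈ Γ} ρ(sx, sy) > 0` for all distinct `x, y ∈ X`, then the naive topological
entropy of the action is zero. -/
theorem distal_implies_zero_naive_entropy
    {Γ : Type*} [Group Γ] [Countable Γ] [Infinite Γ]
    {X : Type*} [MetricSpace X] [CompactSpace X]
    [MulAction Γ X] [ContinuousConstSMul Γ X]
    (hdistal : ∀ x y : X, x ≠ y → ∃ c : ℝ, 0 < c ∧ ∀ s : Γ, c ≤ dist (s • x) (s • y)) :
    naiveEntropy Γ X = 0 := by
  refine le_antisymm (iSup_le fun 𝒰 => ?_) zero_le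
  by_contra hpos
  rw [not_le] at hpos
  set a : ℝ≥0∞ := ⨅ F : {F : Finset Γ // F.Nonempty},
    ENNReal.ofReal (Real.log (coverNum (jointCover F.1 𝒰.1) : ℝ) / (F.1.card : ℝ))
  have hle (F : Finset Γ) (hF : F.Nonempty) :
      a ≤ ENNReal.ofReal (Real.log (coverNum (jointCover F 𝒰.1) : ℝ) / (F.card : ℝ)) :=
    iInf_le _ (⟨F, hF⟩ : {F : Finset Γ // F.Nonempty})
  have htop : a ≠ ⊤ := ne_top_of_le_ne_top ENNReal.ofReal_ne_top
    (hle {1} (Finset.singleton_nonempty 1))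
  obtain ⟨x, y, hxy, hprox⟩ := exists_proximal_pair (Γ := Γ) 𝒰.2
    (ENNReal.toReal_pos hpos.ne' htop) fun F hF => by
      have hF' : (0 : ℝ) < F.card := Nat.cast_pos.2 hF.card_pos
      rw [← le_div_iff₀ hF']
      by_contra hlt
      rw [not_le] at hlt
      have h := hle F hF
      rw [ENNReal.le_ofReal_iff_toReal_le htop
        (div_nonneg (Real.log_natCast_nonneg _) hF'.le)] at h
      linarith
  obtain ⟨c, hc, hdist⟩ := hdistal x y hxy
  obtain ⟨s, hs⟩ := hprox c hc
  exact absurd (hdist s) (not_le.2 hs)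
end

section
/- Let Γ be a countably infinite discrete group acting on a compact metrizable space X by homeomorphisms. If the naive topological entropy h^nv(Γ↷X) is positive, then the action is untame: there exist a continuous function f : X → ℝ, an infinite subset H of Γ, and a constant c > 0 such that for every nonempty finite subset F of H and all real numbers (a_s)_{s∈F} one has sup_{x∈X} |Σ_{s∈F} a_s f(s⁻¹x)| ≥ c Σ_{s∈F} |a_s| (so that δ_s ↦ sf extends to a Banach space isomorphism from ℓ¹(H) onto the closed linear span of {sf : s ∈ H} in C(X)). -/
open scoped ENNReal NNReal

open Finset in
/-- The number of subsets of size at most `ε n` of an `n`-element set is at most `exp (η n)`. -/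
lemma exists_card_small_subsets_le_exp {η : ℝ} (hη : 0 < η) :
    ∃ ε : ℝ, 0 < ε ∧ ε < 1 ∧ ∀ (α : Type*) [Fintype α],
      (#{W : Finset α | (#W : ℝ) ≤ ε * Fintype.card α} : ℝ) ≤
        Real.exp (η * Fintype.card α) := by
  obtain ⟨x, hx0, hx1, hxη⟩ : ∃ x : ℝ, 0 < x ∧ x < 1 ∧ x ≤ η / 2 :=
    ⟨min (η / 2) (1 / 2), by positivity, (min_le_right _ _).trans_lt (by norm_num),
      min_le_left _ _⟩
  have hlog : Real.log x < 0 := Real.log_neg hx0 hx1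
  obtain ⟨ε, hε0, hε1, hε⟩ : ∃ ε : ℝ, 0 < ε ∧ ε < 1 ∧ ε * (-Real.log x) ≤ η / 2 := by
    have : 0 < η / 2 / (-Real.log x) := by
      apply div_pos (by positivity); linarith
    refine ⟨min (η / 2 / (-Real.log x)) (1 / 2), by positivity,
      (min_le_right _ _).trans_lt (by norm_num), ?_⟩
    rw [← le_div_iff₀ (by linarith)]
    exact min_le_left _ _
  refine ⟨ε, hε0, hε1, fun α _ ↦ ?_⟩
  set n := Fintype.card α
  have hsum : ∑ W : Finset α, x ^ #W = (x + 1) ^ n := by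
    have := Finset.sum_pow_mul_eq_add_pow x (1 : ℝ) (univ : Finset α)
    simpa using this
  have hle : (#{W : Finset α | (#W : ℝ) ≤ ε * n} : ℝ) * x ^ (ε * n) ≤ (x + 1) ^ n := by
    rw [← hsum, ← nsmul_eq_mul]
    refine (card_nsmul_le_sum _ (fun W ↦ x ^ #W) _ fun W hW ↦ ?_).trans
      (sum_le_sum_of_subset_of_nonneg (subset_univ _) fun _ _ _ ↦ by positivity)
    rw [← Real.rpow_natCast]
    exact Real.rpow_le_rpow_of_exponent_ge hx0 hx1.le (mem_filter.1 hW).2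
  have hpow : (x + 1) ^ n ≤ Real.exp (η / 2 * n) := by
    rw [mul_comm, Real.exp_nat_mul]
    exact pow_le_pow_left₀ (by positivity) ((Real.add_one_le_exp x).trans
      (Real.exp_le_exp.2 hxη)) n
  have hx : Real.exp (-(η / 2 * n)) ≤ x ^ (ε * n) := by
    rw [Real.rpow_def_of_pos hx0, Real.exp_le_exp]
    have : 0 ≤ (n : ℝ) := by positivity
    nlinarith
  have hmul : (#{W : Finset α | (#W : ℝ) ≤ ε * n} : ℝ) * Real.exp (-(η / 2 * n)) ≤
      Real.exp (η / 2 * n) :=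
    (mul_le_mul_of_nonneg_left hx (by positivity)).trans (hle.trans hpow)
  rw [Real.exp_neg, ← div_eq_mul_inv, div_le_iff₀ (Real.exp_pos _), ← Real.exp_add] at hmul
  exact hmul.trans_eq (by congr 1; ring)

section PartialPatterns

variable {α : Type*}

/-- A partial pattern `p` is compatible with `φ` if it agrees with `φ` wherever it is defined. -/
def PatternCompatible (φ : α → Bool) (p : α → Option Bool) : Prop :=
  ∀ z, p z ≠ some (!φ z)

/-- A set `S` of partial patterns shatters `W` if every pattern on `W` extends to a member. -/
def PatternShatters (S : Finset (α → Option Bool)) (W : Finset α) : Prop :=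
  ∀ ω : α → Bool, ∃ p ∈ S, ∀ z ∈ W, p z = some (ω z)

open Finset Classical

lemma PatternShatters.mono {S T : Finset (α → Option Bool)} {W : Finset α} (hST : S ⊆ T)
    (h : PatternShatters S W) : PatternShatters T W := fun ω ↦
  let ⟨p, hp, hpW⟩ := h ω
  ⟨p, hST hp, hpW⟩

lemma PatternShatters.notMem_of_filter {S : Finset (α → Option Bool)} {W : Finset α} {z : α}
    {i : Bool} (h : PatternShatters {p ∈ S | p z = some i} W) : z ∉ W := by
  intro hz
  obtain ⟨p, hp, hpW⟩ := h fun _ ↦ !i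
  have h1 := hpW z hz
  rw [(mem_filter.1 hp).2] at h1
  cases i <;> simp at h1

lemma card_shattered_add_le [Fintype α] (S : Finset (α → Option Bool)) (z : α) :
    #{W | PatternShatters {p ∈ S | p z = some true} W} +
      #{W | PatternShatters {p ∈ S | p z = some false} W} ≤ #{W | PatternShatters S W} := by
  set A : Finset (Finset α) := {W | PatternShatters {p ∈ S | p z = some true} W} with hA
  set B : Finset (Finset α) := {W | PatternShatters {p ∈ S | p z = some false} W} with hB
  have hzA : ∀ W ∈ A, z ∉ W := fun W hW ↦ (mem_filter.1 hW).2.notMem_of_filter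
  have hzB : ∀ W ∈ B, z ∉ W := fun W hW ↦ (mem_filter.1 hW).2.notMem_of_filter
  have hinj : Set.InjOn (insert z) ((A ∩ B : Finset (Finset α)) : Set (Finset α)) := by
    intro W hW W' hW' h
    have h1 := hzA W (mem_inter.1 hW).1
    have h2 := hzA W' (mem_inter.1 hW').1
    rw [← erase_insert h1, ← erase_insert h2, h]
  have hdisj : Disjoint (A ∪ B) ((A ∩ B).image (insert z)) := by
    rw [disjoint_left]
    intro W hW hW'
    obtain ⟨W', -, rfl⟩ := mem_image.1 hW'
    rcases mem_union.1 hW with h | h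
    · exact hzA _ h (mem_insert_self _ _)
    · exact hzB _ h (mem_insert_self _ _)
  rw [← card_union_add_card_inter, ← card_image_of_injOn hinj, ← card_union_of_disjoint hdisj]
  refine card_le_card fun W hW ↦ mem_filter.2 ⟨mem_univ _, ?_⟩
  rcases mem_union.1 hW with hW | hW
  · rcases mem_union.1 hW with hW | hW
    · exact (mem_filter.1 hW).2.mono (filter_subset _ _)
    · exact (mem_filter.1 hW).2.mono (filter_subset _ _)
  · obtain ⟨W', hW', rfl⟩ := mem_image.1 hW
    have hWA := (mem_filter.1 (mem_inter.1 hW').1).2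
    have hWB := (mem_filter.1 (mem_inter.1 hW').2).2
    intro ω
    cases hω : ω z
    · obtain ⟨p, hp, hpW⟩ := hWB ω
      refine ⟨p, (mem_filter.1 hp).1, ?_⟩
      simp only [mem_insert, forall_eq_or_imp]
      exact ⟨hω ▸ (mem_filter.1 hp).2, hpW⟩
    · obtain ⟨p, hp, hpW⟩ := hWA ω
      refine ⟨p, (mem_filter.1 hp).1, ?_⟩
      simp only [mem_insert, forall_eq_or_imp]
      exact ⟨hω ▸ (mem_filter.1 hp).2, hpW⟩

/-- If no pattern `φ` is compatible with many members of `S`, then there is a coordinate at which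
both labels are taken by a definite proportion of `S`. -/
lemma exists_balanced_coordinate [Fintype α] {ε T : ℝ} (hε : 0 ≤ ε)
    (hT : (#{W : Finset α | (#W : ℝ) ≤ ε * Fintype.card α} : ℝ) ≤ T)
    {S : Finset (α → Option Bool)} (hS : S.Nonempty)
    (h : ∀ φ, 2 * T * #{p ∈ S | PatternCompatible φ p} ≤ #S) :
    ∃ z, ∀ i : Bool, ε / 2 * #S ≤ (#{p ∈ S | p z = some i} : ℝ) := by
  have hφ : ∀ z, ∃ i : Bool, #{p ∈ S | p z = some (!i)} ≤ #{p ∈ S | p z = some i} := by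
    intro z
    rcases le_total #{p ∈ S | p z = some true} #{p ∈ S | p z = some false} with h | h
    · exact ⟨false, h⟩
    · exact ⟨true, h⟩
  choose φ hφ using hφ
  suffices ∃ z, ε / 2 * #S ≤ (#{p ∈ S | p z = some (!φ z)} : ℝ) by
    obtain ⟨z, hz⟩ := this
    refine ⟨z, fun i ↦ ?_⟩
    by_cases hi : i = φ z
    · subst hi
      exact hz.trans (by exact_mod_cast hφ z)
    · have : i = !φ z := by cases i <;> cases hh : φ z <;> simp_all
      rwa [this]
  have hS0 : (0 : ℝ) < #S := by exact_mod_cast hS.card_pos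
  by_contra! hlt
  let dev : (α → Option Bool) → Finset α := fun p ↦ {z | p z = some (!φ z)}
  let small : Finset (Finset α) := {W : Finset α | (#W : ℝ) ≤ ε * Fintype.card α}
  have hT1 : 1 ≤ T := by
    refine le_trans ?_ hT
    have : ∅ ∈ small := by
      simp only [small, mem_filter, mem_univ, true_and, card_empty, Nat.cast_zero]
      positivity
    exact_mod_cast card_pos.2 ⟨_, this⟩
  have hfew : 2 * (#{p ∈ S | dev p ∈ small} : ℝ) ≤ #S := by
    have hfib : ∀ W ∈ small, (#{p ∈ {p ∈ S | dev p ∈ small} | dev p = W} : ℝ) ≤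
        #S / (2 * T) := by
      intro W _
      rw [le_div_iff₀ (by positivity), mul_comm]
      refine le_trans ?_ (h fun z ↦ if z ∈ W then !φ z else φ z)
      gcongr
      intro p hp
      obtain rfl := (mem_filter.1 hp).2
      refine mem_filter.2 ⟨(mem_filter.1 (mem_filter.1 hp).1).1, fun z hz ↦ ?_⟩
      by_cases hd : p z = some (!φ z)
      · simp [dev, hd] at hz
      · simp [dev, hd] at hz
    have hcard : (#{p ∈ S | dev p ∈ small} : ℝ) ≤ #small * (#S / (2 * T)) := by
      rw [card_eq_sum_card_fiberwise (s := {p ∈ S | dev p ∈ small}) (f := dev) (t := small)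
        (fun p hp ↦ (mem_filter.1 hp).2)]
      push_cast
      rw [← nsmul_eq_mul]
      exact sum_le_card_nsmul _ _ _ hfib
    have : (#small : ℝ) * (#S / (2 * T)) ≤ T * (#S / (2 * T)) :=
      mul_le_mul_of_nonneg_right hT (by positivity)
    have h3 : T * (#S / (2 * T)) = #S / 2 := by field_simp
    linarith
  have hcount : ∑ z, (#{p ∈ S | p z = some (!φ z)} : ℝ) = ∑ p ∈ S, (#(dev p) : ℝ) := by
    have := sum_card_bipartiteAbove_eq_sum_card_bipartiteBelow
      (s := (univ : Finset α)) (t := S) (fun z p ↦ p z = some (!φ z))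
    simp only [bipartiteAbove, bipartiteBelow] at this
    exact_mod_cast this
  have hlow : (#S / 2 : ℝ) * (ε * Fintype.card α) ≤ ∑ p ∈ S, (#(dev p) : ℝ) := by
    have hsplit : (#{p ∈ S | dev p ∈ small} : ℝ) + #{p ∈ S | dev p ∉ small} = #S := by
      exact_mod_cast card_filter_add_card_filter_not (s := S) (fun p ↦ dev p ∈ small)
    calc (#S / 2 : ℝ) * (ε * Fintype.card α)
        ≤ #{p ∈ S | dev p ∉ small} * (ε * Fintype.card α) := by
          gcongr; linarith
      _ ≤ ∑ p ∈ S with dev p ∉ small, (#(dev p) : ℝ) := by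
          rw [← nsmul_eq_mul]
          refine card_nsmul_le_sum _ _ _ fun p hp ↦ ?_
          have := (mem_filter.1 hp).2
          simp only [small, mem_filter, mem_univ, true_and, not_le] at this
          exact this.le
      _ ≤ _ := sum_le_sum_of_subset_of_nonneg (filter_subset _ _) fun _ _ _ ↦ by positivity
  rcases isEmpty_or_nonempty α with hα | hα
  · have h1 := h φ
    have h2 : ({p ∈ S | PatternCompatible φ p} : Finset _) = S :=
      filter_true_of_mem fun p _ z ↦ hα.elim z
    rw [h2] at h1
    nlinarith
  · have : ∑ z, (#{p ∈ S | p z = some (!φ z)} : ℝ) < ∑ _z : α, ε / 2 * #S :=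
      sum_lt_sum_of_nonempty univ_nonempty fun z _ ↦ hlt z
    rw [hcount, sum_const, card_univ, nsmul_eq_mul] at this
    linarith

lemma two_pow_le_card_shattered [Fintype α] {ε T : ℝ} (hε : 0 < ε) (hε1 : ε ≤ 1)
    (hT : (#{W : Finset α | (#W : ℝ) ≤ ε * Fintype.card α} : ℝ) ≤ T) (j : ℕ)
    {S : Finset (α → Option Bool)} (hS : S.Nonempty)
    (h : ∀ φ, 2 * T * #{p ∈ S | PatternCompatible φ p} ≤ (ε / 2) ^ j * #S) :
    2 ^ j ≤ #{W | PatternShatters S W} := by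
  have hT0 : 0 ≤ T := (Nat.cast_nonneg _).trans hT
  induction j generalizing S with
  | zero =>
    obtain ⟨p, hp⟩ := hS
    refine card_pos.2 ⟨∅, mem_filter.2 ⟨mem_univ _, fun ω ↦ ⟨p, hp, by simp⟩⟩⟩
  | succ j ih =>
    have hS0 : (0 : ℝ) < #S := by exact_mod_cast hS.card_pos
    obtain ⟨z, hz⟩ := exists_balanced_coordinate hε.le hT hS fun φ ↦ (h φ).trans <|
      mul_le_of_le_one_left hS0.le (pow_le_one₀ (by positivity) (by linarith))
    have key : ∀ i : Bool, 2 ^ j ≤ #{W | PatternShatters {p ∈ S | p z = some i} W} := by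
      intro i
      refine ih ?_ fun φ ↦ ?_
      · have : (0 : ℝ) < #{p ∈ S | p z = some i} := lt_of_lt_of_le (by positivity) (hz i)
        exact card_pos.1 (by exact_mod_cast this)
      · calc 2 * T * (#{p ∈ {p ∈ S | p z = some i} | PatternCompatible φ p} : ℝ)
            ≤ 2 * T * #{p ∈ S | PatternCompatible φ p} := by
              gcongr
              exact filter_subset _ _
          _ ≤ (ε / 2) ^ (j + 1) * #S := h φ
          _ = (ε / 2) ^ j * (ε / 2 * #S) := by ring
          _ ≤ _ := by gcongr; exact hz i
    have := card_shattered_add_le S z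
    have h1 := key true
    have h2 := key false
    rw [pow_succ]
    omega

/-- Greedy covering: if every nonempty subset of `S` has a proportion at least `δ` of members
compatible with a single `φ`, then few `φ`s suffice for all of `S`. -/
lemma exists_greedy_compatible [Fintype α] {δ : ℝ} (hδ : 0 < δ) {S : Finset (α → Option Bool)}
    (h : ∀ A ⊆ S, A.Nonempty → ∃ φ, δ * #A ≤ #{p ∈ A | PatternCompatible φ p}) :
    ∃ Φ : Finset (α → Bool), (#Φ : ℝ) ≤ Real.log 3 * Fintype.card α / δ + 1 ∧
      ∀ p ∈ S, ∃ φ ∈ Φ, PatternCompatible φ p := by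
  have step : ∀ k : ℕ, ∃ Φ : Finset (α → Bool), #Φ ≤ k ∧
      (#{p ∈ S | ∀ φ ∈ Φ, ¬ PatternCompatible φ p} : ℝ) ≤ Real.exp (-δ) ^ k * #S := by
    intro k
    induction k with
    | zero => exact ⟨∅, by simp, by simp⟩
    | succ k ih =>
      obtain ⟨Φ, hΦ, hc⟩ := ih
      set A : Finset (α → Option Bool) := {p ∈ S | ∀ φ ∈ Φ, ¬ PatternCompatible φ p} with hA
      rcases A.eq_empty_or_nonempty with he | hne
      · refine ⟨Φ, by omega, ?_⟩
        rw [← hA, he]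
        simp only [card_empty, Nat.cast_zero]
        positivity
      · obtain ⟨φ, hφ⟩ := h A (filter_subset _ _) hne
        refine ⟨insert φ Φ, (card_insert_le _ _).trans (by omega), ?_⟩
        have heq : ({p ∈ S | ∀ ψ ∈ insert φ Φ, ¬ PatternCompatible ψ p} : Finset _) =
            {p ∈ A | ¬ PatternCompatible φ p} := by
          ext p
          simp only [hA, mem_filter, mem_insert, forall_eq_or_imp]
          tauto
        have hsplit : (#{p ∈ A | PatternCompatible φ p} : ℝ) +
            #{p ∈ A | ¬ PatternCompatible φ p} = #A := by
          exact_mod_cast card_filter_add_card_filter_not (s := A) (PatternCompatible φ)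
        have h1 : 1 - δ ≤ Real.exp (-δ) := by linarith [Real.add_one_le_exp (-δ)]
        calc _ = (#{p ∈ A | ¬ PatternCompatible φ p} : ℝ) := by rw [heq]
          _ ≤ (1 - δ) * #A := by linarith
          _ ≤ Real.exp (-δ) * (Real.exp (-δ) ^ k * #S) := by gcongr
          _ = _ := by ring
  set L := Real.log 3 * Fintype.card α / δ with hL
  have hL0 : 0 ≤ L := by
    have := Real.log_nonneg (x := 3) (by norm_num)
    positivity
  obtain ⟨Φ, hΦ, hc⟩ := step (⌊L⌋₊ + 1)
  refine ⟨Φ, ?_, ?_⟩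
  · have := Nat.floor_le hL0
    have : (#Φ : ℝ) ≤ (⌊L⌋₊ + 1 : ℕ) := by exact_mod_cast hΦ
    push_cast at this
    linarith
  · have hcard : (#S : ℝ) ≤ Real.exp (Real.log 3 * Fintype.card α) := by
      have : #S ≤ 3 ^ Fintype.card α := by
        refine (card_le_univ S).trans ?_
        simp
      rw [mul_comm, Real.exp_nat_mul, Real.exp_log (by norm_num)]
      exact_mod_cast this
    have hlt : (#{p ∈ S | ∀ φ ∈ Φ, ¬ PatternCompatible φ p} : ℝ) < 1 := by
      refine hc.trans_lt ?_
      rw [← Real.exp_nat_mul]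
      calc _ ≤ Real.exp ((⌊L⌋₊ + 1 : ℕ) * -δ) * Real.exp (Real.log 3 * Fintype.card α) := by gcongr
        _ < 1 := by
          rw [← Real.exp_add, Real.exp_lt_one_iff]
          have h1 : L * δ = Real.log 3 * Fintype.card α := by
            rw [hL]; field_simp
          have h2 := Nat.lt_floor_add_one L
          push_cast
          nlinarith
    have hz : #{p ∈ S | ∀ φ ∈ Φ, ¬ PatternCompatible φ p} = 0 := by
      have : #{p ∈ S | ∀ φ ∈ Φ, ¬ PatternCompatible φ p} < 1 := by exact_mod_cast hlt
      omega
    rw [card_eq_zero, filter_eq_empty_iff] at hz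
    intro p hp
    have := hz hp
    push Not at this
    exact this

end PartialPatterns

open Finset in
open scoped Classical in
/-- A large set of partial patterns either is covered by exponentially few total patterns, or
shatters a set of positive proportion. -/
theorem exists_density_shatters_of_covering {b : ℝ} (hb : 0 < b) :
    ∃ q : ℝ, 0 < q ∧ ∃ n₀ : ℕ, ∀ (α : Type*) [Fintype α], n₀ ≤ Fintype.card α →
      ∀ S : Finset (α → Option Bool),
        (∃ Φ : Finset (α → Bool), (#Φ : ℝ) ≤ Real.exp (b * Fintype.card α) ∧
          ∀ p ∈ S, ∃ φ ∈ Φ, PatternCompatible φ p) ∨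
        ∃ W : Finset α, q * Fintype.card α ≤ #W ∧ PatternShatters S W := by
  obtain ⟨ε, hε0, hε1, hε⟩ := exists_card_small_subsets_le_exp (show 0 < b / 4 by positivity)
  have hlogε : 0 < Real.log (2 / ε) := Real.log_pos (by rw [lt_div_iff₀ hε0]; linarith)
  set κ := b / 4 / Real.log (2 / ε) with hκ
  have hκ0 : 0 < κ := by positivity
  have hlog2 : 0 < Real.log 2 := Real.log_pos (by norm_num)
  obtain ⟨q, hq0, -, hq⟩ := exists_card_small_subsets_le_exp
    (show 0 < κ * Real.log 2 / 2 by positivity)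
  have hlog3 : 0 < Real.log 3 := Real.log_pos (by norm_num)
  have hev : ∀ᶠ n : ℕ in Filter.atTop, 2 * Real.log 3 * n * Real.exp (b / 2 * n) + 1 ≤
      Real.exp (b * n) := by
    have h1 : Filter.Tendsto (fun n : ℕ ↦ (n : ℝ)) Filter.atTop Filter.atTop :=
      tendsto_natCast_atTop_atTop
    have h2 := (isLittleO_pow_exp_pos_mul_atTop 1 (show 0 < b / 2 by positivity)).bound
      (show 0 < 1 / (4 * Real.log 3) by positivity)
    have h3 : ∀ᶠ x : ℝ in Filter.atTop, 2 ≤ Real.exp (b * x) := by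
      have : Filter.Tendsto (fun x : ℝ ↦ Real.exp (b * x)) Filter.atTop Filter.atTop :=
        Real.tendsto_exp_atTop.comp (Filter.tendsto_id.const_mul_atTop hb)
      exact this.eventually_ge_atTop 2
    filter_upwards [h1.eventually h2, h1.eventually h3] with n hn hn2
    rw [pow_one, Real.norm_of_nonneg (by positivity), Real.norm_of_nonneg (by positivity)] at hn
    have hsq : Real.exp (b * n) = Real.exp (b / 2 * n) * Real.exp (b / 2 * n) := by
      rw [← Real.exp_add]; congr 1; ring
    have : 2 * Real.log 3 * n * Real.exp (b / 2 * n) ≤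
        2 * Real.log 3 * (1 / (4 * Real.log 3) * Real.exp (b / 2 * n)) * Real.exp (b / 2 * n) := by
      gcongr
    have h4 : 2 * Real.log 3 * (1 / (4 * Real.log 3) * Real.exp (b / 2 * n)) *
        Real.exp (b / 2 * n) = Real.exp (b * n) / 2 := by
      rw [hsq]; field_simp; norm_num
    linarith
  obtain ⟨n₁, hn₁⟩ := Filter.eventually_atTop.1 hev
  obtain ⟨n₂, hn₂⟩ := exists_nat_gt (2 / κ)
  refine ⟨q, hq0, max n₁ n₂, fun α _ hα S ↦ ?_⟩
  set n := Fintype.card α with hn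
  set T := Real.exp (b / 4 * n) with hT
  set j := ⌊κ * n⌋₊ with hj
  have hT0 : 0 < T := Real.exp_pos _
  by_cases h : ∀ A ⊆ S, A.Nonempty →
      ∃ φ, (ε / 2) ^ j / (2 * T) * #A ≤ (#{p ∈ A | PatternCompatible φ p} : ℝ)
  · left
    obtain ⟨Φ, hΦ, hcov⟩ := exists_greedy_compatible (by positivity) h
    refine ⟨Φ, hΦ.trans (le_trans ?_ (hn₁ n (le_of_max_le_left hα))), hcov⟩
    have hjle : (2 / ε) ^ j ≤ Real.exp (b / 4 * n) := by
      rw [← Real.exp_log (show 0 < 2 / ε by positivity), ← Real.exp_nat_mul, Real.exp_le_exp]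
      calc (j : ℝ) * Real.log (2 / ε) ≤ κ * n * Real.log (2 / ε) := by
            gcongr
            exact Nat.floor_le (by positivity)
        _ = b / 4 * n := by rw [hκ]; field_simp
    have heq : Real.log 3 * n / ((ε / 2) ^ j / (2 * T)) =
        2 * Real.log 3 * n * (T * (2 / ε) ^ j) := by
      rw [div_pow, div_pow]; field_simp
    have hexp : Real.exp (b / 2 * n) = T * Real.exp (b / 4 * n) := by
      rw [hT, ← Real.exp_add]; congr 1; ring
    rw [heq, hexp]
    gcongr
  · right
    push Not at h
    obtain ⟨A, hAS, hA, hφ⟩ := h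
    have hcount := two_pow_le_card_shattered hε0 hε1.le (hε α) j hA fun φ ↦ by
      have := (hφ φ).le
      rw [div_mul_eq_mul_div, le_div_iff₀ (by positivity)] at this
      linarith
    by_contra! hW
    have hsub : #{W | PatternShatters A W} ≤ #{W : Finset α | (#W : ℝ) ≤ q * n} := by
      refine card_le_card fun W hW' ↦ mem_filter.2 ⟨mem_univ _, ?_⟩
      by_contra! hlt
      exact hW W hlt.le ((mem_filter.1 hW').2.mono hAS)
    have hlt : (2 : ℝ) ^ j ≤ Real.exp (κ * Real.log 2 / 2 * n) := by
      refine le_trans ?_ (hq α)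
      exact_mod_cast hcount.trans hsub
    rw [← Real.exp_log (show (0 : ℝ) < 2 by norm_num), ← Real.exp_nat_mul, Real.exp_le_exp,
      Real.exp_log (by norm_num)] at hlt
    have h1 : κ * n < j + 1 := Nat.lt_floor_add_one _
    have h2 : 2 < κ * n := by
      have : (n₂ : ℝ) ≤ n := by exact_mod_cast le_of_max_le_right hα
      rw [div_lt_iff₀ hκ0] at hn₂
      nlinarith
    nlinarith

section Translates

variable {Γ : Type*} [Group Γ]

open Finset
open scoped Pointwise

/-- A sequence of finite sets, each the disjoint union of two right translates of the previous
one. -/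
lemma exists_doubling_sequence [DecidableEq Γ] [Infinite Γ] :
    ∃ (F : ℕ → Finset Γ) (g : ℕ → Γ), F 0 = {1} ∧
      (∀ n, F (n + 1) = F n ∪ (F n).image (· * g n)) ∧ ∀ n, #(F n) = 2 ^ n := by
  have hex : ∀ F : Finset Γ, ∃ g : Γ, Disjoint F (F.image (· * g)) := by
    intro F
    obtain ⟨g, hg⟩ := Infinite.exists_notMem_finset (F⁻¹ * F)
    refine ⟨g, disjoint_left.2 fun a ha ha' ↦ hg ?_⟩
    obtain ⟨c, hc, rfl⟩ := mem_image.1 ha'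
    exact mem_mul.2 ⟨c⁻¹, inv_mem_inv hc, c * g, ha, by group⟩
  choose g hg using hex
  let F : ℕ → Finset Γ := fun n ↦ n.rec {1} fun _ F ↦ F ∪ F.image (· * g F)
  refine ⟨F, fun n ↦ g (F n), rfl, fun n ↦ rfl, fun n ↦ ?_⟩
  induction n with
  | zero => rfl
  | succ n ih =>
    change #(F n ∪ (F n).image (· * g (F n))) = _
    rw [card_union_of_disjoint (hg _), card_image_of_injective _ (mul_left_injective _), ih]
    ring

/-- A subset of density at least `q` of `F N` has a right translate meeting each of the sets
`F n * (F n)⁻¹`, `n ≤ N`, in many points. -/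
lemma exists_translate_card_inter_ge [DecidableEq Γ] {F : ℕ → Finset Γ} {g : ℕ → Γ}
    (h0 : F 0 = {1}) (hF : ∀ n, F (n + 1) = F n ∪ (F n).image (· * g n)) (q : ℝ) (N : ℕ)
    {J : Finset Γ} (hJ : J ⊆ F N) (hq : q * 2 ^ N ≤ #J) :
    ∃ x ∈ F N, ∀ n ≤ N, q * 2 ^ n ≤ (#(J.image (· * x⁻¹) ∩ (F n * (F n)⁻¹)) : ℝ) := by
  have hfull : ∀ (n : ℕ) (J : Finset Γ), J ⊆ F n → ∀ x ∈ F n,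
      #(J.image (· * x⁻¹) ∩ (F n * (F n)⁻¹)) = #J := by
    intro n J hJ x hx
    rw [inter_eq_left.2, card_image_of_injective _ (mul_left_injective _)]
    intro y hy
    obtain ⟨s, hs, rfl⟩ := mem_image.1 hy
    exact mul_mem_mul (hJ hs) (inv_mem_inv hx)
  induction N generalizing J with
  | zero =>
    have h1 : (1 : Γ) ∈ F 0 := by simp [h0]
    refine ⟨1, h1, fun n hn ↦ ?_⟩
    obtain rfl : n = 0 := by omega
    rwa [hfull 0 J hJ 1 h1]
  | succ N ih =>
    have main : ∀ (J' : Finset Γ) (y : Γ), J' ⊆ F N → J'.image (· * y) ⊆ J →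
        (∀ x ∈ F N, x * y ∈ F (N + 1)) → q * 2 ^ N ≤ (#J' : ℝ) →
        ∃ x ∈ F (N + 1), ∀ n ≤ N + 1,
          q * 2 ^ n ≤ (#(J.image (· * x⁻¹) ∩ (F n * (F n)⁻¹)) : ℝ) := by
      intro J' y hJ' hsub hy hq'
      obtain ⟨x, hx, hxn⟩ := ih hJ' hq'
      refine ⟨x * y, hy x hx, fun n hn ↦ ?_⟩
      rcases Nat.le_succ_iff.1 hn with hn | rfl
      · refine (hxn n hn).trans ?_
        gcongr
        intro z hz
        obtain ⟨s, hs, rfl⟩ := mem_image.1 hz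
        exact mem_image.2 ⟨s * y, hsub (mem_image_of_mem _ hs), by group⟩
      · rwa [hfull _ J hJ _ (hy x hx)]
    have hcard : #J ≤ #(J ∩ F N) + #{s ∈ F N | s * g N ∈ J} := by
      have : J ⊆ (J ∩ F N) ∪ {s ∈ F N | s * g N ∈ J}.image (· * g N) := by
        intro s hs
        rcases mem_union.1 (hF N ▸ hJ hs) with h | h
        · exact mem_union_left _ (mem_inter.2 ⟨hs, h⟩)
        · obtain ⟨t, ht, rfl⟩ := mem_image.1 h
          exact mem_union_right _ (mem_image_of_mem _ (mem_filter.2 ⟨ht, hs⟩))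
      exact (card_le_card this).trans ((card_union_le _ _).trans
        (Nat.add_le_add_left card_image_le _))
    have hcard' : (#J : ℝ) ≤ #(J ∩ F N) + #{s ∈ F N | s * g N ∈ J} := by exact_mod_cast hcard
    rw [pow_succ] at hq
    rcases le_or_gt (q * 2 ^ N) (#(J ∩ F N) : ℝ) with h | h
    · refine main _ 1 inter_subset_right (by simp [inter_subset_left]) (fun x hx ↦ ?_) h
      rw [hF, mul_one]
      exact mem_union_left _ hx
    · refine main _ (g N) (filter_subset _ _) ?_ (fun x hx ↦ ?_) (by linarith : _ ≤ _)
      · intro s hs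
        obtain ⟨t, ht, rfl⟩ := mem_image.1 hs
        exact (mem_filter.1 ht).2
      · rw [hF]
        exact mem_union_right _ (mem_image_of_mem _ hx)

/-- Every sequence of subsets has a limit in the topology of pointwise convergence along a
subsequence, expressed on finite sets. -/
lemma exists_frequently_forall_mem_iff {ι : Type*} (W : ℕ → Set ι) :
    ∃ V : Set ι, ∀ T : Finset ι, ∃ᶠ N in Filter.atTop, ∀ s ∈ T, s ∈ W N ↔ s ∈ V := by
  refine ⟨{s | ∀ᶠ N in (Filter.hyperfilter ℕ : Filter ℕ), s ∈ W N}, fun T ↦ ?_⟩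
  have : ∀ᶠ N in (Filter.hyperfilter ℕ : Filter ℕ), ∀ s ∈ T,
      s ∈ W N ↔ s ∈ {s | ∀ᶠ N in (Filter.hyperfilter ℕ : Filter ℕ), s ∈ W N} := by
    rw [Filter.eventually_all_finset]
    intro s _
    by_cases hs : ∀ᶠ N in (Filter.hyperfilter ℕ : Filter ℕ), s ∈ W N
    · filter_upwards [hs] with N hN
      simp [hN, hs]
    · have := Ultrafilter.eventually_not.2 hs
      filter_upwards [this] with N hN
      simp [hN, hs]
  exact this.frequently.filter_mono Nat.hyperfilter_le_atTop

/-- A hereditary, right translation invariant family of finite subsets of a group which has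
members of positive density in the sets of a doubling sequence admits an infinite set all of
whose finite subsets are in the family. -/
theorem exists_infinite_of_density [DecidableEq Γ] {F : ℕ → Finset Γ} {g : ℕ → Γ}
    (h0 : F 0 = {1}) (hF : ∀ n, F (n + 1) = F n ∪ (F n).image (· * g n))
    {P : Finset Γ → Prop} (hmono : ∀ J J', J ⊆ J' → P J' → P J)
    (htrans : ∀ J x, P J → P (J.image (· * x))) {q : ℝ} (hq : 0 < q)
    (h : ∃ᶠ N in Filter.atTop, ∃ J ⊆ F N, P J ∧ q * 2 ^ N ≤ (#J : ℝ)) :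
    ∃ W : Set Γ, W.Infinite ∧ ∀ T : Finset Γ, (T : Set Γ) ⊆ W → P T := by
  have hW : ∀ N : ℕ, ∃ W : Finset Γ, P W ∧
      ∀ n ≤ N, q * 2 ^ n ≤ (#(W ∩ (F n * (F n)⁻¹)) : ℝ) := by
    intro N
    obtain ⟨M, hM, J, hJ, hPJ, hqJ⟩ := Filter.frequently_atTop.1 h N
    obtain ⟨x, -, hx⟩ := exists_translate_card_inter_ge h0 hF q M hJ hqJ
    exact ⟨_, htrans J x⁻¹ hPJ, fun n hn ↦ hx n (hn.trans hM)⟩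
  choose W hPW hqW using hW
  obtain ⟨V, hV⟩ := exists_frequently_forall_mem_iff fun N ↦ (W N : Set Γ)
  refine ⟨V, fun hfin ↦ ?_, fun T hT ↦ ?_⟩
  · obtain ⟨n, hn⟩ := pow_unbounded_of_one_lt (#hfin.toFinset / q) (one_lt_two (α := ℝ))
    obtain ⟨N, hN, hNV⟩ := Filter.frequently_atTop.1 (hV (F n * (F n)⁻¹)) n
    have hle := hqW N n hN
    have hsub : W N ∩ (F n * (F n)⁻¹) ⊆ hfin.toFinset := by
      intro s hs
      obtain ⟨hs1, hs2⟩ := mem_inter.1 hs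
      exact hfin.mem_toFinset.2 ((hNV s hs2).1 hs1)
    have : (#(W N ∩ (F n * (F n)⁻¹)) : ℝ) ≤ #hfin.toFinset := by exact_mod_cast card_le_card hsub
    rw [div_lt_iff₀ hq] at hn
    linarith
  · obtain ⟨N, hN⟩ := (hV T).exists
    exact hmono _ _ (fun s hs ↦ (hN s hs).2 (hT hs)) (hPW N)

end Translates

section Actions

variable {Γ X : Type*} [Group Γ] [MulAction Γ X]

/-- The elements of `J` act independently on the pair `(C, D)`. -/
def ActsIndependently (C D : Set X) (J : Finset Γ) : Prop :=
  ∀ ω : Γ → Bool, ∃ x : X, ∀ s ∈ J, s • x ∈ if ω s then C else D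

lemma ActsIndependently.mono {C D : Set X} {J J' : Finset Γ} (hJ : J ⊆ J')
    (h : ActsIndependently C D J') : ActsIndependently C D J := fun ω ↦
  let ⟨x, hx⟩ := h ω
  ⟨x, fun s hs ↦ hx s (hJ hs)⟩

lemma ActsIndependently.image_mul_right [DecidableEq Γ] {C D : Set X} {J : Finset Γ}
    (h : ActsIndependently C D J) (g : Γ) : ActsIndependently C D (J.image (· * g)) := by
  intro ω
  obtain ⟨x, hx⟩ := h fun s ↦ ω (s * g)
  refine ⟨g⁻¹ • x, Finset.forall_mem_image.2 fun s hs ↦ ?_⟩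
  simpa [mul_smul] using hx s hs

open scoped Classical in
/-- The partial pattern recording, for `s ∈ F`, whether `s • x` lies in `C` or in `D`. -/
noncomputable def itinerary (C D : Set X) (F : Finset Γ) (x : X) : F → Option Bool := fun s ↦
  if (s : Γ) • x ∈ C then some true else if (s : Γ) • x ∈ D then some false else none

open Finset in
lemma actsIndependently_of_shatters {C D : Set X} {F : Finset Γ} {S : Finset (F → Option Bool)}
    (hS : ∀ p ∈ S, ∃ x, itinerary C D F x = p) {W : Finset F} (hW : PatternShatters S W) :
    ActsIndependently C D (W.map (Function.Embedding.subtype _)) := by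
  intro ω
  obtain ⟨p, hp, hpW⟩ := hW fun s ↦ ω s
  obtain ⟨x, rfl⟩ := hS p hp
  refine ⟨x, fun s hs ↦ ?_⟩
  obtain ⟨t, ht, rfl⟩ := mem_map.1 hs
  have := hpW t ht
  change _ ∈ if ω (t : Γ) then C else D
  unfold itinerary at this
  split_ifs at this with h1 h2
  · rw [← Option.some_inj.1 this]; simpa using h1
  · rw [← Option.some_inj.1 this]; simpa using h2

open Finset in
/-- The joint cover has a subcover of size at most the product of the covering numbers of the
itineraries for the pairs `(C U, Uᶜ)`, where the sets `C U ⊆ U` still cover. -/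
lemma coverNum_jointCover_le_prod [Nonempty X] {𝒰 : Finset (Set X)} {C : Set X → Set X}
    (hC : ∀ x, ∃ U ∈ 𝒰, x ∈ C U) (hCU : ∀ U ∈ 𝒰, C U ⊆ U) {F : Finset Γ} (Φ : Set X → Finset (F → Bool))
    (hΦ : ∀ U ∈ 𝒰, ∀ x, ∃ φ ∈ Φ U, PatternCompatible φ (itinerary (C U) Uᶜ F x)) :
    coverNum (jointCover F 𝒰) ≤ ∏ U ∈ 𝒰, #(Φ U) := by
  classical
  obtain ⟨U₀, hU₀, -⟩ := hC (Classical.arbitrary X)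
  have hsel : ∀ (c : ∀ U ∈ 𝒰, F → Bool) (s : F), ∃ V ∈ 𝒰,
      (∃ U, ∃ h : U ∈ 𝒰, c U h s = true) → ∃ h : V ∈ 𝒰, c V h s = true := by
    intro c s
    by_cases h : ∃ U, ∃ h : U ∈ 𝒰, c U h s = true
    · obtain ⟨U, hU, hUs⟩ := h
      exact ⟨U, hU, fun _ ↦ ⟨hU, hUs⟩⟩
    · exact ⟨U₀, hU₀, fun h' ↦ absurd h' h⟩
  choose V hV𝒰 hV using hsel
  let Q : (∀ U ∈ 𝒰, F → Bool) → Set X := fun c ↦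
    ⋂ s : Γ, ⋂ h : s ∈ F, (fun x : X ↦ s • x) ⁻¹' V c ⟨s, h⟩
  have hmem : (𝒰.pi Φ).image Q ⊆ jointCover F 𝒰 := by
    intro A hA
    obtain ⟨c, -, rfl⟩ := mem_image.1 hA
    unfold jointCover
    refine mem_image.2 ⟨fun s hs ↦ V c ⟨s, hs⟩, mem_pi.2 fun s hs ↦ hV𝒰 _ _, rfl⟩
  suffices hQ : ⋃₀ (((𝒰.pi Φ).image Q : Finset (Set X)) : Set (Set X)) = Set.univ from
    le_trans (Nat.sInf_le ⟨(𝒰.pi Φ).image Q, hmem, hQ, rfl⟩)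
      (card_image_le.trans (card_pi _ _).le)
  refine Set.eq_univ_of_forall fun x ↦ ?_
  choose! φ hφΦ hφ using fun U hU ↦ hΦ U hU x
  refine ⟨Q fun U _ ↦ φ U, mem_coe.2 (mem_image_of_mem _ (mem_pi.2 fun U hU ↦ hφΦ U hU)), ?_⟩
  simp only [Q, Set.mem_iInter, Set.mem_preimage]
  intro s hs
  obtain ⟨U, hU, hsU⟩ := hC (s • x)
  have hUs : φ U ⟨s, hs⟩ = true := by
    by_contra hne
    refine hφ U hU ⟨s, hs⟩ ?_
    simpa [itinerary, hsU] using hne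
  obtain ⟨h1, h2⟩ := hV (fun U _ ↦ φ U) ⟨s, hs⟩ ⟨U, hU, hUs⟩
  by_contra hne
  refine hφ _ h1 ⟨s, hs⟩ ?_
  have hsub : s • x ∉ C (V (fun U _ ↦ φ U) ⟨s, hs⟩) := fun h ↦ hne (hCU _ h1 h)
  simp [itinerary, hsub, hne, h2]

open Finset in
/-- If a cover has positive naive entropy then in each large finite set one of the pairs
`(C U, Uᶜ)` has an independence set of positive density. -/
lemma exists_density_actsIndependently [Nonempty X] {𝒰 : Finset (Set X)} {C : Set X → Set X}
    (hC : ∀ x, ∃ U ∈ 𝒰, x ∈ C U) (hCU : ∀ U ∈ 𝒰, C U ⊆ U) {c : ℝ} (hc : 0 < c)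
    (h : ∀ F : Finset Γ, F.Nonempty → c * #F ≤ Real.log (coverNum (jointCover F 𝒰))) :
    ∃ q : ℝ, 0 < q ∧ ∃ n₀ : ℕ, ∀ F : Finset Γ, n₀ ≤ #F →
      ∃ U ∈ 𝒰, ∃ J ⊆ F, ActsIndependently (C U) Uᶜ J ∧ q * #F ≤ #J := by
  classical
  set b : ℝ := c / (2 * (#𝒰 + 1)) with hb
  have hb0 : 0 < b := by positivity
  obtain ⟨q, hq, n₀, H⟩ := exists_density_shatters_of_covering hb0
  refine ⟨q, hq, n₀ + 1, fun F hF ↦ ?_⟩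
  by_contra! hno
  have hcov : ∀ U ∈ 𝒰, ∃ Φ : Finset (F → Bool), (#Φ : ℝ) ≤ Real.exp (b * #F) ∧
      ∀ x, ∃ φ ∈ Φ, PatternCompatible φ (itinerary (C U) Uᶜ F x) := by
    intro U hU
    rcases H F (by rw [Fintype.card_coe]; omega)
      {p | ∃ x, itinerary (C U) Uᶜ F x = p} with ⟨Φ, hΦ, hcomp⟩ | ⟨W, hW, hsh⟩
    · rw [Fintype.card_coe] at hΦ
      exact ⟨Φ, hΦ, fun x ↦ hcomp _ (by simp)⟩
    · rw [Fintype.card_coe] at hW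
      have := hno U hU _ (map_subtype_subset W)
        (actsIndependently_of_shatters (fun p hp ↦ (mem_filter.1 hp).2) hsh)
      rw [card_map] at this
      linarith
  choose! Φ hΦ hcomp using hcov
  have hFne : F.Nonempty := card_pos.1 (by omega)
  have hFpos : (0 : ℝ) < #F := by exact_mod_cast hFne.card_pos
  have hlog := h F hFne
  have hN : (coverNum (jointCover F 𝒰) : ℝ) ≤ Real.exp (b * #F) ^ #𝒰 := by
    calc (coverNum (jointCover F 𝒰) : ℝ) ≤ ∏ U ∈ 𝒰, (#(Φ U) : ℝ) := by
          exact_mod_cast coverNum_jointCover_le_prod hC hCU Φ hcomp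
      _ ≤ ∏ U ∈ 𝒰, Real.exp (b * #F) :=
          prod_le_prod (fun _ _ ↦ by positivity) fun U hU ↦ hΦ U hU
      _ = _ := by simp
  have hNpos : (0 : ℝ) < coverNum (jointCover F 𝒰) := by
    rcases Nat.eq_zero_or_pos (coverNum (jointCover F 𝒰)) with h0 | h0
    · rw [h0, Nat.cast_zero, Real.log_zero] at hlog
      nlinarith
    · exact_mod_cast h0
  have hle := Real.log_le_log hNpos hN
  rw [← Real.exp_nat_mul, Real.log_exp] at hle
  have h3 : (#𝒰 : ℝ) * b < c := by
    rw [hb, mul_div_assoc', div_lt_iff₀ (by positivity)]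
    nlinarith [show (0 : ℝ) ≤ #𝒰 by positivity]
  nlinarith

open Finset in
/-- If every finite subset of an infinite set acts independently on a pair of disjoint closed
sets, then a function separating the two sets spans a copy of `ℓ¹`. -/
lemma exists_l1_lower_bound_of_actsIndependently [TopologicalSpace X] [NormalSpace X]
    {C D : Set X} (hC : IsClosed C) (hD : IsClosed D) (hCD : Disjoint C D)
    {W : Set Γ} (hW : W.Infinite)
    (hind : ∀ T : Finset Γ, (T : Set Γ) ⊆ W → ActsIndependently C D T) :
    ∃ (f : C(X, ℝ)) (H : Set Γ), H.Infinite ∧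
      ∃ c : ℝ, 0 < c ∧
        ∀ F : Finset Γ, (F : Set Γ) ⊆ H → F.Nonempty → ∀ a : Γ → ℝ,
          ∃ x : X, c * ∑ s ∈ F, |a s| ≤ |∑ s ∈ F, a s * f (s⁻¹ • x)| := by
  classical
  obtain ⟨f, hf0, hf1, -⟩ := exists_continuous_zero_one_of_isClosed hD hC hCD.symm
  refine ⟨⟨fun x ↦ 2 * f x - 1, by fun_prop⟩, W⁻¹, Set.infinite_inv.2 hW, 1, one_pos, fun F hF _ a ↦ ?_⟩
  obtain ⟨x, hx⟩ := hind (F.image (·⁻¹)) (by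
    intro s hs
    obtain ⟨t, ht, rfl⟩ := mem_image.1 hs
    exact hF ht) fun s ↦ decide (0 ≤ a s⁻¹)
  refine ⟨x, ?_⟩
  rw [one_mul]
  refine le_trans (le_of_eq (sum_congr rfl fun s hs ↦ ?_)) (le_abs_self _)
  have hsx := hx s⁻¹ (mem_image_of_mem _ hs)
  rw [inv_inv] at hsx
  change |a s| = a s * (2 * f (s⁻¹ • x) - 1)
  rcases le_or_gt 0 (a s) with h | h
  · rw [decide_eq_true h, if_pos rfl] at hsx
    rw [hf1 hsx, abs_of_nonneg h, Pi.one_apply]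
    ring
  · rw [decide_eq_false h.not_ge] at hsx
    rw [hf0 (by simpa using hsx), abs_of_neg h, Pi.zero_apply]
    ring

end Actions

/-- If a countably infinite group `Γ` acts by homeomorphisms on a compact metrizable
space `X` with positive naive topological entropy, then the action is untame: there are
a continuous function `f : X → ℝ`, an infinite subset `H ⊆ Γ` and a constant `c > 0`
such that for every nonempty finite `F ⊆ H` and all reals `(a_s)_{s ∈ F}` one has
`sup_{x ∈ X} |∑_{s ∈ F} a_s f(s⁻¹x)| ≥ c ∑_{s ∈ F} |a_s|` (the supremum being attained
at some point `x` of the compact space `X`), so that `δ_s ↦ s f` extends to a Banach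
space isomorphism from `ℓ¹(H)` onto the closed linear span of `{sf : s ∈ H}` in `C(X)`. -/
theorem positive_naive_entropy_implies_untame
    {Γ : Type*} [Group Γ] [Countable Γ] [Infinite Γ]
    {X : Type*} [TopologicalSpace X] [CompactSpace X] [TopologicalSpace.MetrizableSpace X]
    [MulAction Γ X] [ContinuousConstSMul Γ X]
    (h : 0 < naiveEntropy Γ X) :
    ∃ (f : C(X, ℝ)) (H : Set Γ), H.Infinite ∧
      ∃ c : ℝ, 0 < c ∧
        ∀ F : Finset Γ, (F : Set Γ) ⊆ H → F.Nonempty → ∀ a : Γ → ℝ,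
          ∃ x : X, c * ∑ s ∈ F, |a s| ≤ |∑ s ∈ F, a s * f (s⁻¹ • x)| := by
  classical
  obtain ⟨⟨𝒰, h𝒰, hcov⟩, hpos⟩ := lt_iSup_iff.1 h
  obtain ⟨c, hc, hclt⟩ := ENNReal.lt_iff_exists_nnreal_btwn.1 hpos
  have hc0 : (0 : ℝ) < c := by exact_mod_cast hc
  have hent : ∀ F : Finset Γ, F.Nonempty →
      (c : ℝ) * F.card ≤ Real.log (coverNum (jointCover F 𝒰)) := by
    intro F hF
    have h1 := hclt.trans_le (iInf_le _ (⟨F, hF⟩ : {F : Finset Γ // F.Nonempty}))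
    rw [← ENNReal.ofReal_coe_nnreal] at h1
    rw [← le_div_iff₀ (by exact_mod_cast hF.card_pos)]
    exact ((ENNReal.ofReal_lt_ofReal_iff_of_nonneg c.2).1 h1).le
  obtain ⟨C', hC'cov, hC'closed, hC'sub⟩ := exists_iUnion_eq_closed_subset
    (u := fun U : 𝒰 ↦ (U : Set X)) (fun U ↦ h𝒰 U U.2) (fun _ ↦ Set.toFinite _)
    (by rw [← hcov, Set.sUnion_eq_iUnion]; rfl)
  let C : Set X → Set X := fun U ↦ if hU : U ∈ 𝒰 then C' ⟨U, hU⟩ else ∅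
  have hC : ∀ x, ∃ U ∈ 𝒰, x ∈ C U := by
    intro x
    obtain ⟨U, hU⟩ := Set.mem_iUnion.1 (hC'cov ▸ Set.mem_univ x)
    exact ⟨U, U.2, by simpa [C] using hU⟩
  have hCU : ∀ U ∈ 𝒰, C U ⊆ U := fun U hU ↦ by simpa [C, hU] using hC'sub ⟨U, hU⟩
  have hCclosed : ∀ U ∈ 𝒰, IsClosed (C U) := fun U hU ↦ by
    simpa [C, hU] using hC'closed ⟨U, hU⟩
  have hne : Nonempty X := by
    by_contra hX
    rw [not_nonempty_iff] at hX
    have h1 := hent {1} (Finset.singleton_nonempty 1)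
    have h2 : coverNum (jointCover ({1} : Finset Γ) 𝒰) = 0 :=
      Nat.le_zero.1 (Nat.sInf_le ⟨∅, by simp, Subsingleton.elim _ _, rfl⟩)
    rw [h2] at h1
    simp at h1
    linarith
  obtain ⟨q, hq, n₀, H⟩ := exists_density_actsIndependently hC hCU hc0 hent
  obtain ⟨F, g, hF0, hFs, hFcard⟩ := exists_doubling_sequence (Γ := Γ)
  have hfreq : ∃ U ∈ 𝒰, ∃ᶠ N in Filter.atTop, ∃ J ⊆ F N,
      ActsIndependently (C U) Uᶜ J ∧ q * 2 ^ N ≤ (J.card : ℝ) := by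
    by_contra hno
    have hev : ∀ᶠ N in Filter.atTop, ∀ U ∈ 𝒰, ¬ ∃ J ⊆ F N,
        ActsIndependently (C U) Uᶜ J ∧ q * 2 ^ N ≤ (J.card : ℝ) :=
      (Filter.eventually_all_finset 𝒰).2 fun U hU ↦
        Filter.not_frequently.1 fun h ↦ hno ⟨U, hU, h⟩
    obtain ⟨N, hN, hN₀⟩ := (hev.and (Filter.eventually_ge_atTop n₀)).exists
    obtain ⟨U, hU, J, hJ, hind, hqJ⟩ := H (F N) (by
      rw [hFcard]; exact hN₀.trans Nat.lt_two_pow_self.le)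
    refine hN U hU ⟨J, hJ, hind, ?_⟩
    rw [hFcard] at hqJ
    exact_mod_cast hqJ
  obtain ⟨U, hU, hfreq⟩ := hfreq
  obtain ⟨W, hW, hWind⟩ := exists_infinite_of_density hF0 hFs
    (fun _ _ hJ h ↦ h.mono hJ) (fun _ x h ↦ h.image_mul_right x) hq hfreq
  exact exists_l1_lower_bound_of_actsIndependently (hCclosed U hU) (h𝒰 U hU).isClosed_compl
    (Set.disjoint_compl_right_iff_subset.2 (hCU U hU)) hW hWind
end

section
/- Let Γ be a countably infinite discrete group acting on a compact metrizable space X by homeomorphisms. The following are equivalent: (1) the naive topological entropy h^nv(Γ↷X) is positive; (2) there is a finite pairwise disjoint closed family of 2-tuples of subsets of X with positive independence density; (3) there is a finite pairwise disjoint closed family of tuples of subsets of X, each tuple of length at least 2, with positive independence density. -/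
open scoped ENNReal NNReal

/-- `J ⊆ Γ` is an independence set for a tuple `A = (A_i)_{i : ι}` of subsets of `X` if
for every nonempty finite `F ⊆ J` and every map `ω : F → ι`, the intersection
`⋂_{s ∈ F} s⁻¹ A_{ω(s)}` is nonempty. -/
def IsIndepSet {Γ : Type*} [Group Γ] {X : Type*} [MulAction Γ X] {ι : Type*}
    (A : ι → Set X) (J : Set Γ) : Prop :=
  ∀ F : Finset Γ, (F : Set Γ) ⊆ J → F.Nonempty → ∀ ω : Γ → ι,
    (⋂ s ∈ F, (fun x : X => s • x) ⁻¹' A (ω s)).Nonempty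

/-- A finite family `(A i)_{i : ι}` of tuples of subsets of `X` (the tuple `A i` being
indexed by `κ i`) has positive independence density if there is some `q > 0` such that
for every nonempty finite `F ⊆ Γ` there are `J ⊆ F` with `|J| ≥ q|F|` and some `i` such
that `J` is an independence set for `A i`. -/
def HasPosIndepDensity (Γ : Type*) [Group Γ] {X : Type*} [MulAction Γ X]
    {ι : Type*} {κ : ι → Type*} (A : ∀ i, κ i → Set X) : Prop :=
  ∃ q : ℝ, 0 < q ∧ ∀ F : Finset Γ, F.Nonempty →
    ∃ J : Finset Γ, J ⊆ F ∧ q * (F.card : ℝ) ≤ (J.card : ℝ) ∧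
      ∃ i, IsIndepSet (A i) (J : Set Γ)

open scoped Classical in
/-- The number of subsets of `Z` shattered by the points of `S`, where `P z v` is the set of points
carrying the label `v` at `z`. -/
noncomputable def shatterCount {Γ X : Type*} (P : Γ → Fin 2 → Set X) (Z : Finset Γ)
    (S : Set X) : ℕ :=
  (Z.powerset.filter fun W => ∀ ω : Γ → Fin 2, ∃ x ∈ S, ∀ z ∈ W, x ∈ P z (ω z)).card

theorem shatterCount_mono {Γ X : Type*} (P : Γ → Fin 2 → Set X) {Z Z' : Finset Γ} {S S' : Set X}
    (hZ : Z ⊆ Z') (hS : S ⊆ S') : shatterCount P Z S ≤ shatterCount P Z' S' := by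
  classical
  unfold shatterCount
  apply Finset.card_le_card
  intro W hW
  simp only [Finset.mem_filter, Finset.mem_powerset] at hW ⊢
  refine ⟨hW.1.trans hZ, fun ω => ?_⟩
  obtain ⟨x, hx, h⟩ := hW.2 ω
  exact ⟨x, hS hx, h⟩

theorem shatterCount_pos {Γ X : Type*} (P : Γ → Fin 2 → Set X) (Z : Finset Γ) {S : Set X}
    (hS : S.Nonempty) : 0 < shatterCount P Z S := by
  classical
  obtain ⟨x, hx⟩ := hS
  refine Finset.card_pos.2 ⟨∅, ?_⟩
  simp only [Finset.mem_filter, Finset.mem_powerset]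
  exact ⟨Finset.empty_subset _, fun _ => ⟨x, hx, by simp⟩⟩

theorem shatterCount_add_le {Γ X : Type*} [DecidableEq Γ] (P : Γ → Fin 2 → Set X)
    {Z : Finset Γ} {z : Γ} (hz : z ∉ Z) (S : Set X) :
    shatterCount P Z (S ∩ P z 0) + shatterCount P Z (S ∩ P z 1) ≤
      shatterCount P (insert z Z) S := by
  classical
  unfold shatterCount
  rw [← Finset.card_union_add_card_inter]
  set A₀ := Z.powerset.filter fun W => ∀ ω : Γ → Fin 2, ∃ x ∈ S ∩ P z 0, ∀ y ∈ W, x ∈ P y (ω y)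
    with hA₀
  set A₁ := Z.powerset.filter fun W => ∀ ω : Γ → Fin 2, ∃ x ∈ S ∩ P z 1, ∀ y ∈ W, x ∈ P y (ω y)
    with hA₁
  have hcard : ((A₀ ∩ A₁).image (insert z)).card = (A₀ ∩ A₁).card := by
    apply Finset.card_image_of_injOn
    intro W hW W' hW' h
    simp only [hA₀, hA₁, Finset.coe_inter, Finset.coe_filter, Finset.mem_powerset,
      Set.mem_inter_iff, Set.mem_ofPred_eq] at hW hW'
    have h1 : z ∉ W := fun h => hz (hW.1.1 h)
    have h2 : z ∉ W' := fun h => hz (hW'.1.1 h)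
    rw [← Finset.erase_insert h1, ← Finset.erase_insert h2]
    exact congrArg (fun T => T.erase z) h
  rw [← hcard, ← Finset.card_union_of_disjoint]
  · apply Finset.card_le_card
    intro W hW
    simp only [hA₀, hA₁, Finset.mem_union, Finset.mem_image, Finset.mem_inter, Finset.mem_filter,
      Finset.mem_powerset] at hW ⊢
    rcases hW with (⟨hW, h⟩ | ⟨hW, h⟩) | ⟨V, ⟨⟨hV, h0⟩, -, h1⟩, rfl⟩
    · refine ⟨hW.trans (Finset.subset_insert _ _), fun ω => ?_⟩
      obtain ⟨x, hx, hxW⟩ := h ω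
      exact ⟨x, hx.1, hxW⟩
    · refine ⟨hW.trans (Finset.subset_insert _ _), fun ω => ?_⟩
      obtain ⟨x, hx, hxW⟩ := h ω
      exact ⟨x, hx.1, hxW⟩
    · refine ⟨Finset.insert_subset_insert _ hV, fun ω => ?_⟩
      have key : ∃ x ∈ S ∩ P z (ω z), ∀ y ∈ V, x ∈ P y (ω y) := by
        rcases (by omega : ω z = 0 ∨ ω z = 1) with hω | hω
        · rw [hω]; exact h0 ω
        · rw [hω]; exact h1 ω
      obtain ⟨x, hx, hxV⟩ := key
      exact ⟨x, hx.1, by simpa using ⟨hx.2, hxV⟩⟩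
  · rw [Finset.disjoint_left]
    intro W hW hW'
    obtain ⟨V, -, rfl⟩ := Finset.mem_image.1 hW'
    have : insert z V ⊆ Z := by
      rcases Finset.mem_union.1 hW with h | h
      · exact Finset.mem_powerset.1 (Finset.mem_filter.1 h).1
      · exact Finset.mem_powerset.1 (Finset.mem_filter.1 h).1
    exact hz (this (Finset.mem_insert_self _ _))

/-- A halving argument: the points of `S` avoid few patterns, in terms of the number of sets
that `S` shatters. -/
theorem exists_avoiding_patterns {Γ X : Type*} (P : Γ → Fin 2 → Set X)
    (hP : ∀ z, Disjoint (P z 0) (P z 1)) (a : ℕ) (Z : Finset Γ) (S : Set X) :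
    ∃ C : Finset (Γ → Fin 2),
      (C.card : ℝ) ≤ (1 + (1 / 2 : ℝ) ^ a) ^ Z.card * (shatterCount P Z S : ℝ) ^ a ∧
      ∀ x ∈ S, ∃ c ∈ C, ∀ z ∈ Z, x ∉ P z (c z) := by
  classical
  induction Z using Finset.induction_on generalizing S with
  | empty =>
    rcases S.eq_empty_or_nonempty with rfl | hS
    · exact ⟨∅, by simp, by simp⟩
    · refine ⟨{fun _ => 0}, ?_, fun x _ => ⟨_, Finset.mem_singleton_self _, by simp⟩⟩
      have : (1 : ℝ) ≤ shatterCount P ∅ S := by exact_mod_cast shatterCount_pos P ∅ hS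
      simpa using one_le_pow₀ this
  | insert z Z hz ih =>
    have hv : ∃ v : Fin 2, 2 * shatterCount P Z (S ∩ P z v) ≤ shatterCount P (insert z Z) S := by
      have := shatterCount_add_le P hz S
      rcases le_total (shatterCount P Z (S ∩ P z 0)) (shatterCount P Z (S ∩ P z 1)) with h | h
      · exact ⟨0, by omega⟩
      · exact ⟨1, by omega⟩
    obtain ⟨v, hv⟩ := hv
    have hdisj : ∀ x ∈ P z v, x ∉ P z (v + 1) := by
      intro x hx hx'
      rcases (by omega : v = 0 ∨ v = 1) with rfl | rfl
      · exact Set.disjoint_left.1 (hP z) hx hx'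
      · exact Set.disjoint_left.1 (hP z) hx' hx
    obtain ⟨C₁, hC₁, h₁⟩ := ih (S \ P z v)
    obtain ⟨C₂, hC₂, h₂⟩ := ih (S ∩ P z v)
    refine ⟨C₁.image (fun c => Function.update c z v) ∪
      C₂.image (fun c => Function.update c z (v + 1)), ?_, ?_⟩
    · have hcard : ((C₁.image (fun c => Function.update c z v) ∪
          C₂.image (fun c => Function.update c z (v + 1))).card : ℝ) ≤ C₁.card + C₂.card := by
        exact_mod_cast (Finset.card_union_le _ _).trans
          (add_le_add Finset.card_image_le Finset.card_image_le)
      set N := (shatterCount P (insert z Z) S : ℝ) with hN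
      have e1 : (shatterCount P Z (S \ P z v) : ℝ) ≤ N := by
        rw [hN]
        exact_mod_cast shatterCount_mono P (Finset.subset_insert _ _) Set.sdiff_subset
      have e2 : (shatterCount P Z (S ∩ P z v) : ℝ) ≤ 1 / 2 * N := by
        have : (2 * shatterCount P Z (S ∩ P z v) : ℝ) ≤ N := by
          rw [hN]
          exact_mod_cast hv
        linarith
      have f1 := hC₁.trans (mul_le_mul_of_nonneg_left
        (pow_le_pow_left₀ (by positivity) e1 a) (by positivity))
      have f2 := hC₂.trans (mul_le_mul_of_nonneg_left
        (pow_le_pow_left₀ (by positivity) e2 a) (by positivity))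
      rw [Finset.card_insert_of_notMem hz, pow_succ]
      rw [mul_pow] at f2
      linarith
    · intro x hx
      have hne : ∀ y ∈ Z, y ≠ z := fun y hy h => hz (h ▸ hy)
      by_cases hxv : x ∈ P z v
      · obtain ⟨c, hc, hcx⟩ := h₂ x ⟨hx, hxv⟩
        refine ⟨_, Finset.mem_union_right _ (Finset.mem_image_of_mem _ hc), fun y hy => ?_⟩
        rcases Finset.mem_insert.1 hy with rfl | hy
        · simpa using hdisj x hxv
        · simpa [Function.update_of_ne (hne y hy)] using hcx y hy
      · obtain ⟨c, hc, hcx⟩ := h₁ x ⟨hx, hxv⟩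
        refine ⟨_, Finset.mem_union_left _ (Finset.mem_image_of_mem _ hc), fun y hy => ?_⟩
        rcases Finset.mem_insert.1 hy with rfl | hy
        · simpa using hxv
        · simpa [Function.update_of_ne (hne y hy)] using hcx y hy

theorem exists_card_le_exp_of_small_subsets {ε : ℝ} (hε : 0 < ε) :
    ∃ q : ℝ, 0 < q ∧ ∀ {Γ : Type*} (Z : Finset Γ) (T : Finset (Finset Γ)), T ⊆ Z.powerset →
      (∀ W ∈ T, (W.card : ℝ) ≤ q * Z.card) → (T.card : ℝ) ≤ Real.exp (ε * Z.card) := by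
  obtain ⟨L, hL, hLε⟩ : ∃ L : ℝ, 0 < L ∧ Real.exp (-L) ≤ ε / 2 := by
    have := Real.tendsto_exp_neg_atTop_nhds_zero.eventually (eventually_le_nhds (half_pos hε))
    obtain ⟨L, h1, h2⟩ := (this.and (Filter.eventually_gt_atTop 0)).exists
    exact ⟨L, h2, h1⟩
  refine ⟨ε / (2 * L), by positivity, fun {Γ} Z T hT hcard => ?_⟩
  set y := Real.exp (-L) with hy
  have hterm : ∀ W ∈ T, Real.exp (-(ε / 2 * Z.card)) ≤ y ^ W.card := by
    intro W hW
    rw [hy, ← Real.exp_nat_mul, Real.exp_le_exp]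
    have h := mul_le_mul_of_nonneg_right (hcard W hW) hL.le
    have : ε / (2 * L) * Z.card * L = ε / 2 * Z.card := by field_simp
    linarith
  have hsum : (T.card : ℝ) * Real.exp (-(ε / 2 * Z.card)) ≤ (y + 1) ^ Z.card := by
    calc (T.card : ℝ) * Real.exp (-(ε / 2 * Z.card))
        = ∑ W ∈ T, Real.exp (-(ε / 2 * Z.card)) := by simp
      _ ≤ ∑ W ∈ T, y ^ W.card := Finset.sum_le_sum hterm
      _ ≤ ∑ W ∈ Z.powerset, y ^ W.card :=
          Finset.sum_le_sum_of_subset_of_nonneg hT fun _ _ _ => by positivity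
      _ = (y + 1) ^ Z.card := by
          simpa using Finset.sum_pow_mul_eq_add_pow y 1 Z
  have hexp : (y + 1) ^ Z.card ≤ Real.exp (ε / 2 * Z.card) := by
    rw [mul_comm, Real.exp_nat_mul]
    refine pow_le_pow_left₀ (by positivity) ((Real.add_one_le_exp y).trans ?_) _
    exact Real.exp_le_exp.2 hLε
  have := hsum.trans hexp
  rw [Real.exp_neg, ← div_eq_mul_inv, div_le_iff₀ (Real.exp_pos _), ← Real.exp_add] at this
  rwa [← add_mul, add_halves] at this

theorem exists_few_avoiding_patterns {ε : ℝ} (hε : 0 < ε) :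
    ∃ q : ℝ, 0 < q ∧ ∀ {Γ : Type*} {X : Type*} (P : Γ → Fin 2 → Set X) (Z : Finset Γ),
      (∀ z, Disjoint (P z 0) (P z 1)) →
      (∀ W ⊆ Z, (∀ ω : Γ → Fin 2, ∃ x, ∀ z ∈ W, x ∈ P z (ω z)) → (W.card : ℝ) ≤ q * Z.card) →
      ∃ C : Finset (Γ → Fin 2), (C.card : ℝ) ≤ Real.exp (ε * Z.card) ∧
        ∀ x, ∃ c ∈ C, ∀ z ∈ Z, x ∉ P z (c z) := by
  obtain ⟨a, ha, haε⟩ : ∃ a : ℕ, a ≠ 0 ∧ (1 / 2 : ℝ) ^ a ≤ ε / 2 := by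
    have := (tendsto_pow_atTop_nhds_zero_of_lt_one (by norm_num : (0 : ℝ) ≤ 1 / 2)
      (by norm_num)).eventually (eventually_le_nhds (half_pos hε))
    obtain ⟨a, h1, h2⟩ := (this.and (Filter.eventually_ne_atTop 0)).exists
    exact ⟨a, h2, h1⟩
  have ha' : (0 : ℝ) < a := by positivity
  obtain ⟨q, hq, hbound⟩ := exists_card_le_exp_of_small_subsets
    (show 0 < ε / (2 * a) by positivity)
  refine ⟨q, hq, fun {Γ X} P Z hP hW => ?_⟩
  obtain ⟨C, hC, hcov⟩ := exists_avoiding_patterns P hP a Z Set.univ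
  refine ⟨C, hC.trans ?_, fun x => hcov x trivial⟩
  have h1 : (shatterCount P Z Set.univ : ℝ) ≤ Real.exp (ε / (2 * a) * Z.card) := by
    classical
    refine hbound Z _ (Finset.filter_subset _ _) fun W h => ?_
    simp only [Finset.mem_filter, Finset.mem_powerset, Set.mem_univ, true_and] at h
    exact hW W h.1 h.2
  have h2 : (shatterCount P Z Set.univ : ℝ) ^ a ≤ Real.exp (ε / 2 * Z.card) := by
    refine (pow_le_pow_left₀ (by positivity) h1 a).trans_eq ?_
    rw [← Real.exp_nat_mul]
    congr 1
    field_simp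
  have h3 : (1 + (1 / 2 : ℝ) ^ a) ^ Z.card ≤ Real.exp (ε / 2 * Z.card) := by
    rw [mul_comm, Real.exp_nat_mul, add_comm]
    refine pow_le_pow_left₀ (by positivity) ((Real.add_one_le_exp _).trans ?_) _
    exact Real.exp_le_exp.2 haε
  calc _ ≤ Real.exp (ε / 2 * Z.card) * Real.exp (ε / 2 * Z.card) := by gcongr
    _ = Real.exp (ε * Z.card) := by rw [← Real.exp_add]; congr 1; ring

theorem mem_jointCover {Γ X : Type*} [Group Γ] [MulAction Γ X] {F : Finset Γ}
    {𝒰 : Finset (Set X)} {V : Set X} :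
    V ∈ jointCover F 𝒰 ↔ ∃ ω : Γ → Set X, (∀ s ∈ F, ω s ∈ 𝒰) ∧ V = {x | ∀ s ∈ F, s • x ∈ ω s} := by
  classical
  simp only [jointCover, Finset.mem_image, Finset.mem_pi]
  constructor
  · rintro ⟨ω, hω, rfl⟩
    refine ⟨fun s => if h : s ∈ F then ω s h else ∅, fun s hs => by simpa [hs] using hω s hs, ?_⟩
    ext x
    simp only [Set.mem_iInter, Set.mem_preimage, Set.mem_ofPred_eq]
    refine forall_congr' fun s => forall_congr' fun hs => ?_
    simp [hs]
  · rintro ⟨ω, hω, rfl⟩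
    refine ⟨fun s _ => ω s, hω, ?_⟩
    ext x
    simp

theorem sUnion_jointCover {Γ X : Type*} [Group Γ] [MulAction Γ X] (F : Finset Γ)
    {𝒰 : Finset (Set X)} (h𝒰 : ⋃₀ (𝒰 : Set (Set X)) = Set.univ) :
    ⋃₀ (jointCover F 𝒰 : Set (Set X)) = Set.univ := by
  refine Set.eq_univ_of_forall fun x => ?_
  have h : ∀ s : Γ, ∃ U ∈ 𝒰, s • x ∈ U := fun s => by
    have : s • x ∈ ⋃₀ (𝒰 : Set (Set X)) := h𝒰 ▸ Set.mem_univ _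
    simpa using this
  choose ω hω hx using h
  exact ⟨_, Finset.mem_coe.2 (mem_jointCover.2 ⟨ω, fun s _ => hω s, rfl⟩), fun s _ => hx s⟩

theorem coverNum_jointCover_le_card {Γ X : Type*} [Group Γ] [MulAction Γ X] (F : Finset Γ)
    (𝒰 : Finset (Set X)) (T : Finset (Γ → Set X)) (hT : ∀ ω ∈ T, ∀ s ∈ F, ω s ∈ 𝒰)
    (hcov : ∀ x : X, ∃ ω ∈ T, ∀ s ∈ F, s • x ∈ ω s) :
    coverNum (jointCover F 𝒰) ≤ T.card := by
  classical
  refine (Nat.sInf_le ?_).trans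
    (Finset.card_image_le (s := T) (f := fun ω => {x : X | ∀ s ∈ F, s • x ∈ ω s}))
  refine ⟨_, ?_, ?_, rfl⟩
  · intro V hV
    obtain ⟨ω, hω, rfl⟩ := Finset.mem_image.1 hV
    exact mem_jointCover.2 ⟨ω, hT ω hω, rfl⟩
  · refine Set.eq_univ_of_forall fun x => ?_
    obtain ⟨ω, hω, hx⟩ := hcov x
    exact ⟨_, Finset.mem_coe.2 (Finset.mem_image_of_mem _ hω), hx⟩

theorem two_pow_card_le_coverNum {Γ X : Type*} [Group Γ] [MulAction Γ X] {F J : Finset Γ}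
    {𝒰 : Finset (Set X)} (h𝒰 : ⋃₀ (𝒰 : Set (Set X)) = Set.univ) (B : Fin 2 → Set X)
    (hB : ∀ U ∈ 𝒰, ∃ v, Disjoint U (B v)) (hJF : J ⊆ F) (hJ : J.Nonempty)
    (hind : IsIndepSet B (J : Set Γ)) : 2 ^ J.card ≤ coverNum (jointCover F 𝒰) := by
  classical
  obtain ⟨𝒱, h𝒱, hcov, hcard⟩ : coverNum (jointCover F 𝒰) ∈ _ :=
    Nat.sInf_mem ⟨_, jointCover F 𝒰, subset_rfl, sUnion_jointCover F h𝒰, rfl⟩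
  rw [← hcard]
  have hx : ∀ ω : J → Fin 2, ∃ x : X, ∀ s : J, (s : Γ) • x ∈ B (ω s) := by
    intro ω
    obtain ⟨x, hx⟩ := hind J subset_rfl hJ fun s => if h : s ∈ J then ω ⟨s, h⟩ else 0
    refine ⟨x, fun s => ?_⟩
    have := Set.mem_iInter₂.1 hx s s.2
    simpa using this
  choose x hx using hx
  have hV : ∀ ω : J → Fin 2, ∃ V ∈ 𝒱, x ω ∈ V := fun ω => by
    have : x ω ∈ ⋃₀ (𝒱 : Set (Set X)) := hcov ▸ Set.mem_univ _
    simpa using this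
  choose V hV hxV using hV
  have hinj : Function.Injective V := by
    intro ω ω' h
    obtain ⟨u, hu, hVu⟩ := mem_jointCover.1 (h𝒱 (hV ω))
    have m1 := hxV ω
    have m2 := hxV ω'
    rw [← h, hVu] at m2
    rw [hVu] at m1
    funext s
    obtain ⟨v, hv⟩ := hB _ (hu s (hJF s.2))
    have n1 : ω s ≠ v := by
      rintro rfl
      exact Set.disjoint_left.1 hv (m1 s (hJF s.2)) (hx ω s)
    have n2 : ω' s ≠ v := by
      rintro rfl
      exact Set.disjoint_left.1 hv (m2 s (hJF s.2)) (hx ω' s)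
    omega
  calc 2 ^ J.card = (Finset.univ : Finset (J → Fin 2)).card := by simp
    _ ≤ 𝒱.card := Finset.card_le_card_of_injOn V (fun ω _ => hV ω) hinj.injOn

theorem naiveEntropy_pos_of_hasPosIndepDensity {Γ X : Type*} [Group Γ] [TopologicalSpace X]
    [MulAction Γ X] {n : ℕ} {A : Fin n → Fin 2 → Set X}
    (hdisj : ∀ i, ∀ j₁ j₂ : Fin 2, j₁ ≠ j₂ → Disjoint (A i j₁) (A i j₂))
    (hclosed : ∀ i j, IsClosed (A i j)) (hA : HasPosIndepDensity Γ A) :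
    0 < naiveEntropy Γ X := by
  classical
  obtain ⟨q, hq, hA⟩ := hA
  let 𝒰 : Finset (Set X) :=
    (Finset.univ : Finset (Fin n → Fin 2)).image fun c => ⋂ i, (A i (c i))ᶜ
  have h𝒰 : IsFinOpenCover 𝒰 := by
    constructor
    · intro U hU
      obtain ⟨c, -, rfl⟩ := Finset.mem_image.1 hU
      exact isOpen_iInter_of_finite fun i => (hclosed i (c i)).isOpen_compl
    · refine Set.eq_univ_of_forall fun x => ?_
      have : ∀ i, ∃ v, x ∉ A i v := by
        intro i
        by_contra! h
        exact Set.disjoint_left.1 (hdisj i 0 1 (by simp)) (h 0) (h 1)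
      choose c hc using this
      exact ⟨_, Finset.mem_coe.2 (Finset.mem_image_of_mem _ (Finset.mem_univ c)),
        Set.mem_iInter.2 hc⟩
  have hpos : 0 < ENNReal.ofReal (q * Real.log 2) :=
    ENNReal.ofReal_pos.2 (mul_pos hq (Real.log_pos one_lt_two))
  refine hpos.trans_le (le_iSup_of_le ⟨𝒰, h𝒰⟩ (le_iInf ?_))
  rintro ⟨F, hF⟩
  apply ENNReal.ofReal_le_ofReal
  have hF' : (0 : ℝ) < F.card := by exact_mod_cast hF.card_pos
  obtain ⟨J, hJF, hJ, i, hi⟩ := hA F hF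
  have hJne : J.Nonempty := by
    rw [← Finset.card_pos]
    exact_mod_cast (mul_pos hq hF').trans_le hJ
  have hN : ((2 : ℝ) ^ J.card) ≤ coverNum (jointCover F 𝒰) := by
    refine mod_cast two_pow_card_le_coverNum h𝒰.2 (A i) (fun U hU => ?_) hJF hJne hi
    obtain ⟨c, -, rfl⟩ := Finset.mem_image.1 hU
    exact ⟨c i, Set.disjoint_left.2 fun x hx => Set.mem_iInter.1 hx i⟩
  rw [le_div_iff₀ hF']
  calc q * Real.log 2 * F.card = q * F.card * Real.log 2 := by ring
    _ ≤ J.card * Real.log 2 := by gcongr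
    _ = Real.log ((2 : ℝ) ^ J.card) := by rw [Real.log_pow]
    _ ≤ _ := Real.log_le_log (by positivity) hN

theorem exists_hasPosIndepDensity_of_naiveEntropy_pos {Γ X : Type*} [Group Γ]
    [TopologicalSpace X] [NormalSpace X] [MulAction Γ X] (h : 0 < naiveEntropy Γ X) :
    ∃ (n : ℕ) (A : Fin n → Fin 2 → Set X),
      (∀ i, ∀ j₁ j₂ : Fin 2, j₁ ≠ j₂ → Disjoint (A i j₁) (A i j₂)) ∧
      (∀ i j, IsClosed (A i j)) ∧ HasPosIndepDensity Γ A := by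
  classical
  obtain ⟨⟨𝒰, hopen, hcov⟩, hpos⟩ := lt_iSup_iff.1 h
  obtain ⟨δ, hδ, hδ'⟩ := ENNReal.lt_iff_exists_nnreal_btwn.1 hpos
  have hδ0 : (0 : ℝ) < δ := by exact_mod_cast hδ
  have hlog : ∀ F : Finset Γ, F.Nonempty →
      (δ : ℝ) * F.card ≤ Real.log (coverNum (jointCover F 𝒰)) := by
    intro F hF
    have h1 := hδ'.le.trans (iInf_le _ ⟨F, hF⟩)
    rw [← ENNReal.ofReal_coe_nnreal, ENNReal.ofReal_le_ofReal_iff'] at h1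
    have hF' : (0 : ℝ) < F.card := by exact_mod_cast hF.card_pos
    rw [← le_div_iff₀ hF']
    exact h1.resolve_right (not_le.2 hδ0)
  set n := 𝒰.card
  let U : Fin n → Set X := fun i => 𝒰.equivFin.symm i
  have hU : ∀ i, U i ∈ 𝒰 := fun i => (𝒰.equivFin.symm i).2
  have hUcov : ⋃ i, U i = Set.univ := by
    refine Set.eq_univ_of_forall fun x => ?_
    obtain ⟨V, hV, hx⟩ : x ∈ ⋃₀ (𝒰 : Set (Set X)) := hcov ▸ Set.mem_univ _
    exact Set.mem_iUnion.2 ⟨𝒰.equivFin ⟨V, hV⟩, by simpa [U] using hx⟩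
  obtain ⟨K, hKcov, hK, hKU⟩ := exists_iUnion_eq_closed_subset (fun i => hopen _ (hU i))
    (fun _ => Set.toFinite _) hUcov
  have hd : ∀ i, Disjoint (K i) (U i)ᶜ :=
    fun i => Set.disjoint_left.2 fun x hx hx' => hx' (hKU i hx)
  let A : Fin n → Fin 2 → Set X := fun i => ![K i, (U i)ᶜ]
  refine ⟨n, A, ?_, ?_, ?_⟩
  · intro i j₁ j₂ hj
    fin_cases j₁ <;> fin_cases j₂ <;> first | exact absurd rfl hj | skip
    · exact hd i
    · exact (hd i).symm
  · intro i j
    fin_cases j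
    · exact hK i
    · exact (hopen _ (hU i)).isClosed_compl
  have hε : 0 < (δ : ℝ) / (n + 1) := by positivity
  obtain ⟨q, hq, hpat⟩ := exists_few_avoiding_patterns hε
  refine ⟨q, hq, fun F hF => ?_⟩
  by_contra! hcon
  have hF' : (0 : ℝ) < F.card := by exact_mod_cast hF.card_pos
  have hC : ∀ i, ∃ C : Finset (Γ → Fin 2), (C.card : ℝ) ≤ Real.exp (δ / (n + 1) * F.card) ∧
      ∀ x : X, ∃ c ∈ C, ∀ s ∈ F, s • x ∉ A i (c s) := by
    intro i
    refine hpat (fun s v => (fun x : X => s • x) ⁻¹' A i v) F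
      (fun s => (hd i).preimage _) fun W hWF hW => ?_
    by_contra! hlt
    refine hcon W hWF hlt.le i fun E hE _ ω => ?_
    obtain ⟨x, hx⟩ := hW ω
    exact ⟨x, Set.mem_iInter₂.2 fun s hs => hx s (hE hs)⟩
  choose C hCcard hCcov using hC
  let D : Finset (Fin n → Γ → Fin 2) :=
    (Fintype.piFinset C).filter fun c => ∀ s ∈ F, ∃ i, c i s = 1
  let T : Finset (Γ → Set X) :=
    D.image fun c s => if h : ∃ i, c i s = 1 then U h.choose else ∅
  have hTcard : coverNum (jointCover F 𝒰) ≤ T.card := by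
    refine coverNum_jointCover_le_card F 𝒰 T ?_ ?_
    · intro ω hω s hs
      obtain ⟨c, hc, rfl⟩ := Finset.mem_image.1 hω
      have := (Finset.mem_filter.1 hc).2 s hs
      simp only [this, dite_true]
      exact hU _
    · intro x
      choose c hc hcx using fun i => hCcov i x
      have hex : ∀ s ∈ F, ∃ i, c i s = 1 := by
        intro s hs
        obtain ⟨i, hi⟩ := Set.mem_iUnion.1 (hKcov ▸ Set.mem_univ (s • x) : s • x ∈ ⋃ i, K i)
        refine ⟨i, ?_⟩
        have h0 : c i s ≠ 0 := fun h0 => hcx i s hs (by rw [h0]; exact hi)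
        omega
      refine ⟨_, Finset.mem_image_of_mem _
        (Finset.mem_filter.2 ⟨Fintype.mem_piFinset.2 hc, hex⟩), fun s hs => ?_⟩
      simp only [hex s hs, dite_true]
      have h1 := hcx (hex s hs).choose s hs
      rw [(hex s hs).choose_spec] at h1
      exact not_not.1 h1
  have hNle : (coverNum (jointCover F 𝒰) : ℝ) ≤ Real.exp (n * (δ / (n + 1) * F.card)) := by
    calc (coverNum (jointCover F 𝒰) : ℝ) ≤ (Fintype.piFinset C).card := by
          exact_mod_cast hTcard.trans (Finset.card_image_le.trans (Finset.card_filter_le _ _))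
      _ = ∏ i, ((C i).card : ℝ) := by rw [Fintype.card_piFinset]; push_cast; rfl
      _ ≤ ∏ _i : Fin n, Real.exp (δ / (n + 1) * F.card) :=
          Finset.prod_le_prod (fun _ _ => by positivity) fun i _ => hCcard i
      _ = _ := by rw [Finset.prod_const, Finset.card_univ, Fintype.card_fin, Real.exp_nat_mul]
  have hNpos : (0 : ℝ) < coverNum (jointCover F 𝒰) := by
    by_contra! h0
    have h0' : (coverNum (jointCover F 𝒰) : ℝ) = 0 := le_antisymm h0 (by positivity)
    have := hlog F hF
    rw [h0', Real.log_zero] at this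
    exact absurd this (not_le.2 (mul_pos hδ0 hF'))
  have hle := (hlog F hF).trans ((Real.log_le_iff_le_exp hNpos).2 hNle)
  have heq : (n : ℝ) * (δ / (n + 1) * F.card) = δ * F.card - δ / (n + 1) * F.card := by
    field_simp
    ring
  have := mul_pos hε hF'
  linarith

/-- For a continuous action of a countably infinite group `Γ` on a compact metrizable
space `X`, the following are equivalent: (1) the naive topological entropy is positive;
(2) there is a finite pairwise disjoint closed family of 2-tuples of subsets of `X` with
positive independence density; (3) there is a finite pairwise disjoint closed family of
tuples of subsets of `X`, each of length at least 2, with positive independence density. -/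
theorem positive_naive_entropy_iff_pos_indep_density
    {Γ : Type*} [Group Γ] [Countable Γ] [Infinite Γ]
    {X : Type*} [TopologicalSpace X] [CompactSpace X] [TopologicalSpace.MetrizableSpace X]
    [MulAction Γ X] [ContinuousConstSMul Γ X] :
    ((0 < naiveEntropy Γ X) ↔
      ∃ (n : ℕ) (A : Fin n → Fin 2 → Set X),
        (∀ i, ∀ j₁ j₂ : Fin 2, j₁ ≠ j₂ → Disjoint (A i j₁) (A i j₂)) ∧
        (∀ i j, IsClosed (A i j)) ∧
        HasPosIndepDensity Γ A) ∧
    ((0 < naiveEntropy Γ X) ↔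
      ∃ (n : ℕ) (k : Fin n → ℕ), (∀ i, 2 ≤ k i) ∧
        ∃ A : ∀ i, Fin (k i) → Set X,
          (∀ i, ∀ j₁ j₂, j₁ ≠ j₂ → Disjoint (A i j₁) (A i j₂)) ∧
          (∀ i j, IsClosed (A i j)) ∧
          HasPosIndepDensity Γ A) := by
  have h12 : 0 < naiveEntropy Γ X ↔
      ∃ (n : ℕ) (A : Fin n → Fin 2 → Set X),
        (∀ i, ∀ j₁ j₂ : Fin 2, j₁ ≠ j₂ → Disjoint (A i j₁) (A i j₂)) ∧
        (∀ i j, IsClosed (A i j)) ∧ HasPosIndepDensity Γ A :=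
    ⟨exists_hasPosIndepDensity_of_naiveEntropy_pos,
      fun ⟨_, _, hdisj, hclosed, hA⟩ => naiveEntropy_pos_of_hasPosIndepDensity hdisj hclosed hA⟩
  refine ⟨h12, h12.trans ⟨?_, ?_⟩⟩
  · rintro ⟨n, A, hdisj, hclosed, hA⟩
    exact ⟨n, fun _ => 2, fun _ => le_rfl, A, hdisj, hclosed, hA⟩
  · rintro ⟨n, k, hk, A, hdisj, hclosed, q, hq, hA⟩
    refine ⟨n, fun i j => A i (Fin.castLE (hk i) j), fun i j₁ j₂ hj => hdisj i _ _ fun h =>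
      hj (Fin.castLE_injective _ h), fun i j => hclosed i _, q, hq, fun F hF => ?_⟩
    obtain ⟨J, hJF, hJ, i, hi⟩ := hA F hF
    exact ⟨J, hJF, hJ, i, fun E hE hne ω => hi E hE hne fun s => Fin.castLE (hk i) (ω s)⟩
end

section
/- Let X be a compact metrizable space. For any finite open cover 𝒰 of X there exist n ∈ ℕ and open covers 𝒰₁, …, 𝒰ₙ of X, each consisting of exactly two open sets, such that the common refinement ⋁_{j=1}^n 𝒰_j is finer than 𝒰 (every member of ⋁_{j=1}^n 𝒰_j is contained in some member of 𝒰). -/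
/-- For any finite open cover `𝒰` of a compact metrizable space `X` there exist
`n ∈ ℕ` and two-element open covers `𝒰_j = {U j, V j}` (`j = 1, …, n`) of `X` such that
the common refinement `⋁_{j=1}^n 𝒰_j` is finer than `𝒰`: every set of the form
`⋂_j C j` with each `C j ∈ {U j, V j}` is contained in some member of `𝒰`. -/
theorem exists_two_element_covers_refining
    {X : Type*} [TopologicalSpace X] [CompactSpace X] [TopologicalSpace.MetrizableSpace X]
    [Nonempty X]
    (𝒰 : Finset (Set X)) (hopen : ∀ U ∈ 𝒰, IsOpen U)
    (hcover : ⋃₀ (𝒰 : Set (Set X)) = Set.univ) :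
    ∃ (n : ℕ) (U V : Fin n → Set X),
      (∀ j, IsOpen (U j)) ∧ (∀ j, IsOpen (V j)) ∧ (∀ j, U j ∪ V j = Set.univ) ∧
      ∀ C : Fin n → Set X, (∀ j, C j = U j ∨ C j = V j) →
        ∃ W ∈ 𝒰, (⋂ j, C j) ⊆ W := by
  obtain ⟨K, hK, hKc, hKs⟩ := exists_iUnion_eq_closed_subset
    (u := fun W : 𝒰 => (W : Set X)) (fun W => hopen W W.2) (fun _ => Set.toFinite _)
    (by rw [← hcover, Set.sUnion_eq_iUnion]; rfl)
  let e := 𝒰.equivFin.symm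
  refine ⟨𝒰.card, fun j => (e j : Set X), fun j => (K (e j))ᶜ, fun j => hopen _ (e j).2,
    fun j => (hKc _).isOpen_compl, fun j => ?_, fun C hC => ?_⟩
  · refine Set.eq_univ_of_forall fun x => ?_
    by_cases hx : x ∈ K (e j)
    · exact Or.inl (hKs _ hx)
    · exact Or.inr hx
  · by_cases h : ∃ j, C j = (e j : Set X)
    · obtain ⟨j, hj⟩ := h
      exact ⟨e j, (e j).2, hj ▸ Set.iInter_subset C j⟩
    · push Not at h
      obtain ⟨W, hW, -⟩ : ∃ W ∈ 𝒰, Classical.arbitrary X ∈ W := by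
        simpa using hcover.symm.subset (Set.mem_univ (Classical.arbitrary X))
      refine ⟨W, hW, fun x hx => ?_⟩
      obtain ⟨W', hW'⟩ := Set.mem_iUnion.1 (hK.symm.subset (Set.mem_univ x))
      have hx' := Set.mem_iInter.1 hx (e.symm W')
      rw [(hC (e.symm W')).resolve_left (h _)] at hx'
      exact absurd (by simpa using hW') hx'
end
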